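/- Suppose φ ∈ L¹(ℝ) satisfies ∫_ℝ e^{iπnt} φ(t) dt = 0 and ∫_ℝ e^{−iπn/t} φ(t) dt = 0 for every integer n ≥ 0. Then the Fourier transform φ̂(ξ) := ∫_ℝ e^{−2πiξt} φ(t) dt vanishes for every ξ < 0; that is, φ belongs to the Hardy space H¹₊(ℝ) of integrable functions on ℝ whose Fourier transform is supported in [0, +∞) (equivalently, whose harmonic extension to the upper half-plane is holomorphic). -/

import Mathlib

open MeasureTheory

section

open Filter Topology Set

/-- Cauchy's theorem on the upper half-plane for functions with quadratic decay. -/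
theorem integral_eq_zero_of_differentiableOn_upper {F : ℂ → ℂ} {C : ℝ}
    (hd : DifferentiableOn ℂ F {z | 0 < z.im})
    (hb : ∀ z : ℂ, 0 < z.im → ‖F z‖ ≤ C / (1 + ‖z‖ ^ 2))
    (hc : ∀ t : ℝ, t ≠ 0 → ContinuousAt F t) :
    ∫ t : ℝ, F t = 0 := by
  have hC : 0 ≤ C := by
    have h := (norm_nonneg _).trans (hb Complex.I (by simp))
    by_contra! hC
    exact absurd h (not_le.2 (div_neg_of_neg_of_pos hC (by positivity)))
  set y : ℕ → ℝ := fun n => 1 / ((n : ℝ) + 1) with hy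
  have hy0 : ∀ n, 0 < y n := fun n => by simp only [hy]; positivity
  have hyt : Tendsto y atTop (𝓝 0) := tendsto_one_div_add_atTop_nhds_zero_nat
  have hR : ∀ n : ℕ, (0 : ℝ) < n + 1 := fun n => by positivity
  set G : ℕ → ℝ → ℂ := fun n => indicator (Ioc (-((n : ℝ) + 1)) (n + 1))
    fun t => F (t + y n * Complex.I) with hG
  have hlim : Tendsto (fun n => ∫ t, G n t) atTop (𝓝 (∫ t : ℝ, F t)) := by
    refine tendsto_integral_of_dominated_convergence (fun t => C / (1 + t ^ 2)) ?_ ?_ ?_ ?_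
    · intro n
      refine AEStronglyMeasurable.indicator ?_ measurableSet_Ioc
      refine Continuous.aestronglyMeasurable ?_
      refine hd.continuousOn.comp_continuous (by fun_prop) fun t => ?_
      simp [hy0]
    · simpa [div_eq_mul_inv] using integrable_inv_one_add_sq.const_mul C
    · intro n
      refine Eventually.of_forall fun t => ?_
      refine (norm_indicator_le_norm_self _ _).trans ((hb _ (by simp [hy0])).trans ?_)
      refine div_le_div_of_nonneg_left hC (by positivity) ?_
      rw [← Complex.normSq_eq_norm_sq, Complex.normSq_apply]
      simp
      nlinarith [hy0 n]
    · have h0 : ∀ᵐ t : ℝ, t ≠ 0 := by simp [ae_iff]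
      filter_upwards [h0] with t ht
      have h2 : Tendsto (fun n => F (t + y n * Complex.I)) atTop (𝓝 (F t)) := by
        refine (hc t ht).tendsto.comp ?_
        have : Tendsto (fun n => (t : ℂ) + (y n : ℂ) * Complex.I) atTop
            (𝓝 ((t : ℂ) + ((0 : ℝ) : ℂ) * Complex.I)) :=
          ((Complex.continuous_ofReal.tendsto _ |>.comp hyt).mul_const _).const_add _
        simpa using this
      refine h2.congr' ?_
      obtain ⟨N, hN⟩ := exists_nat_gt |t|
      filter_upwards [eventually_ge_atTop N] with n hn
      have : (N : ℝ) ≤ n := by exact_mod_cast hn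
      simp only [hG]
      rw [indicator_of_mem]
      constructor <;> linarith [neg_abs_le t, le_abs_self t]
  have hzero : Tendsto (fun n => ∫ t, G n t) atTop (𝓝 0) := by
    have hbd : ∀ n : ℕ, ‖∫ t, G n t‖ ≤ 4 * C * y n := by
      intro n
      set R : ℝ := (n : ℝ) + 1 with hRdef
      have hRp : 0 < R := hR n
      have hyR : y n ≤ R := by
        simp only [hy]
        rw [← hRdef, div_le_iff₀ hRp]
        have : (1 : ℝ) ≤ R := by simp [hRdef]
        nlinarith
      have hyR' : y n = 1 / R := rfl
      rw [hG]
      simp only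
      rw [integral_indicator measurableSet_Ioc, ← intervalIntegral.integral_of_le (by linarith)]
      have hrect := Complex.integral_boundary_rect_eq_zero_of_differentiableOn F
        (-R + y n * Complex.I) (R + R * Complex.I) (hd.mono ?_)
      swap
      · intro z hz
        have := hz.2
        simp [uIcc_of_le hyR] at this
        exact (hy0 n).trans_le this.1
      simp at hrect
      have key : ∀ z : ℂ, 0 < z.im → R ^ 2 ≤ ‖z‖ ^ 2 → ‖F z‖ ≤ C / R ^ 2 := by
        intro z hz h
        refine (hb z hz).trans ?_
        gcongr
        linarith
      have htop : ‖∫ x : ℝ in -R..R, F (x + R * Complex.I)‖ ≤ C / R ^ 2 * |R - -R| := by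
        refine intervalIntegral.norm_integral_le_of_norm_le_const fun x _ => key _ (by simpa) ?_
        rw [← Complex.normSq_eq_norm_sq, Complex.normSq_apply]
        simp
        nlinarith
      have hside : ∀ s : ℝ, s ^ 2 = R ^ 2 →
          ‖∫ t : ℝ in y n..R, F (s + t * Complex.I)‖ ≤ C / R ^ 2 * |R - y n| := by
        intro s hs
        refine intervalIntegral.norm_integral_le_of_norm_le_const fun x hx => ?_
        rw [uIoc_of_le hyR] at hx
        refine key _ (by simpa using (hy0 n).trans hx.1) ?_
        rw [← Complex.normSq_eq_norm_sq, Complex.normSq_apply]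
        simp
        nlinarith
      have hl := hside (-R) (by ring)
      have hr := hside R rfl
      rw [abs_of_nonneg (by linarith)] at htop hl hr
      have heq : (∫ t : ℝ in -R..R, F (t + y n * Complex.I)) =
          (∫ t : ℝ in -R..R, F (t + R * Complex.I))
          - Complex.I * (∫ t : ℝ in y n..R, F (R + t * Complex.I))
          + Complex.I * (∫ t : ℝ in y n..R, F ((-R : ℝ) + t * Complex.I)) := by
        push_cast
        linear_combination hrect
      rw [heq]
      refine (norm_add_le _ _).trans ((add_le_add_left (norm_sub_le _ _) _).trans ?_)
      rw [norm_mul, norm_mul, Complex.norm_I, one_mul, one_mul, hyR']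
      have h3 : C / R ^ 2 * (R - y n) ≤ C / R ^ 2 * R := by
        gcongr
        linarith [hy0 n]
      have h4 : C / R ^ 2 * R = C * (1 / R) := by field_simp
      have h5 : C / R ^ 2 * (R - -R) = 2 * (C * (1 / R)) := by field_simp; ring
      linarith
    refine squeeze_zero_norm hbd ?_
    simpa using hyt.const_mul (4 * C)
  exact tendsto_nhds_unique hlim hzero

/-- Functions holomorphic on the closed upper half-plane with quadratic decay. -/
def UpperDecay (Q : ℂ → ℂ) : Prop :=
  (∀ z : ℂ, 0 ≤ z.im → DifferentiableAt ℂ Q z) ∧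
    ∃ C : ℝ, ∀ z : ℂ, 0 ≤ z.im → ‖Q z‖ ≤ C / (1 + ‖z‖ ^ 2)

theorem UpperDecay.mul {Q B : ℂ → ℂ} (hQ : UpperDecay Q)
    (hB : ∀ z : ℂ, 0 ≤ z.im → DifferentiableAt ℂ B z) {K : ℝ}
    (hK : ∀ z : ℂ, 0 ≤ z.im → ‖B z‖ ≤ K) : UpperDecay (fun z => B z * Q z) := by
  obtain ⟨hd, C, hC⟩ := hQ
  refine ⟨fun z hz => (hB z hz).mul (hd z hz), K * C, fun z hz => ?_⟩
  rw [norm_mul, mul_div_assoc]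
  exact mul_le_mul (hK z hz) (hC z hz) (norm_nonneg _) ((norm_nonneg _).trans (hK z hz))

theorem UpperDecay.integrable {Q : ℂ → ℂ} (hQ : UpperDecay Q) :
    Integrable fun t : ℝ => Q t := by
  obtain ⟨hd, C, hC⟩ := hQ
  refine Integrable.mono' (integrable_inv_one_add_sq.const_mul C) ?_ ?_
  · refine Continuous.aestronglyMeasurable (continuous_iff_continuousAt.2 fun t => ?_)
    exact (hd t (by simp)).continuousAt.comp (f := fun t : ℝ => (t : ℂ))
      Complex.continuous_ofReal.continuousAt
  · refine Eventually.of_forall fun t => (hC t (by simp)).trans (le_of_eq ?_)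
    simp [div_eq_mul_inv]

theorem UpperDecay.integral_exp_mul_exp_eq_zero {Q : ℂ → ℂ} (hQ : UpperDecay Q) {a b : ℝ}
    (ha : 0 ≤ a) (hb : 0 ≤ b) :
    ∫ t : ℝ, Complex.exp (Complex.I * a * t) * Complex.exp (-(Complex.I * b) / t) * Q t = 0 := by
  obtain ⟨hd, C, hC⟩ := hQ
  have hdiff : ∀ z : ℂ, z ≠ 0 → 0 ≤ z.im → DifferentiableAt ℂ (fun z : ℂ =>
      Complex.exp (Complex.I * a * z) * Complex.exp (-(Complex.I * b) / z) * Q z) z := by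
    intro z hz hz'
    have := hd z hz'
    have : DifferentiableAt ℂ (fun z : ℂ => -(Complex.I * b) / z) z :=
      (differentiableAt_const _).div differentiableAt_id hz
    fun_prop
  refine integral_eq_zero_of_differentiableOn_upper (F := fun z : ℂ =>
    Complex.exp (Complex.I * a * z) * Complex.exp (-(Complex.I * b) / z) * Q z) (C := C) ?_ ?_ ?_
  · intro z hz
    have hz : 0 < z.im := hz
    exact (hdiff z (fun h => by simp [h] at hz) hz.le).differentiableWithinAt
  · intro z hz
    rw [norm_mul, norm_mul, Complex.norm_exp, Complex.norm_exp]
    have h1 : (Complex.I * a * z).re ≤ 0 := by simp; positivity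
    have h2 : (-(Complex.I * b) / z).re ≤ 0 := by
      simp only [Complex.div_re, Complex.neg_re, Complex.neg_im, Complex.mul_re, Complex.mul_im,
        Complex.I_re, Complex.I_im, Complex.ofReal_re, Complex.ofReal_im]
      have : 0 ≤ b * z.im / Complex.normSq z :=
        div_nonneg (mul_nonneg hb hz.le) (Complex.normSq_nonneg z)
      simp only [zero_mul, mul_zero, sub_zero, one_mul, zero_add, neg_zero, zero_div]
      rw [neg_mul, neg_div]
      linarith
    refine le_trans ?_ (hC z hz.le)
    refine mul_le_of_le_one_left (norm_nonneg _) ?_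
    exact mul_le_one₀ (Real.exp_le_one_iff.2 h1) (Real.exp_nonneg _) (Real.exp_le_one_iff.2 h2)
  · intro t ht
    exact (hdiff t (by exact_mod_cast ht) (by simp)).continuousAt

/-- The character `t ↦ e^{iπmt}` of period `2`. -/
noncomputable def char2 (m : ℤ) (t : ℝ) : ℂ := Complex.exp (Complex.I * Real.pi * m * t)

theorem norm_char2 (m : ℤ) (t : ℝ) : ‖char2 m t‖ = 1 := by
  rw [char2, show Complex.I * (Real.pi : ℂ) * m * t = ((Real.pi * m * t : ℝ) : ℂ) * Complex.I by
    push_cast; ring, Complex.norm_exp_ofReal_mul_I]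

theorem continuous_char2 (m : ℤ) : Continuous (char2 m) := by
  unfold char2
  fun_prop

theorem char2_add (m : ℤ) (s t : ℝ) : char2 m (s + t) = char2 m s * char2 m t := by
  rw [char2, char2, char2, ← Complex.exp_add]
  congr 1
  push_cast
  ring

theorem char2_two_mul_int (m k : ℤ) : char2 m (2 * k) = 1 := by
  rw [char2, Complex.exp_eq_one_iff]
  exact ⟨m * k, by push_cast; ring⟩

theorem char2_neg_mul (m : ℤ) (t : ℝ) : char2 (-m) t * char2 m t = 1 := by
  rw [char2, char2, ← Complex.exp_add, Complex.exp_eq_one_iff]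
  exact ⟨0, by push_cast; ring⟩

theorem intervalIntegral_char2 {m : ℤ} (hm : m ≠ 0) : ∫ t in (-1 : ℝ)..1, char2 m t = 0 := by
  have hc : Complex.I * Real.pi * m ≠ 0 := by
    simp [Real.pi_ne_zero, hm]
  unfold char2
  rw [integral_exp_mul_complex hc]
  have : Complex.exp (Complex.I * Real.pi * m * ((1 : ℝ) : ℂ)) =
      Complex.exp (Complex.I * Real.pi * m * ((-1 : ℝ) : ℂ)) := by
    rw [Complex.exp_eq_exp_iff_exists_int]
    exact ⟨m, by push_cast; ring⟩
  rw [this]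
  simp

theorem continuous_integral_mul_comp_add {ψ u : ℝ → ℂ} {K : ℝ} (hψ : Integrable ψ)
    (hu : Measurable u) (hK : ∀ t, ‖u t‖ ≤ K) :
    Continuous fun x : ℝ => ∫ t, ψ t * u (t + x) := by
  have hu' : MemLp u ⊤ (volume : Measure ℝ) :=
    memLp_top_of_bound hu.aestronglyMeasurable K (Eventually.of_forall hK)
  have h1 : ∀ x : ℝ, ∫ t, ψ t * u (t + x) = ∫ t, ψ (-x + t) * u t := by
    intro x
    rw [← integral_add_left_eq_self (fun t => ψ (-x + t) * u t) x]
    refine integral_congr_ae (Eventually.of_forall fun t => ?_)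
    simp [add_comm]
  simp_rw [h1]
  have hm : MemLp ψ 1 (volume : Measure ℝ) := memLp_one_iff_integrable.2 hψ
  have hL : Continuous fun g : Lp ℂ 1 (volume : Measure ℝ) => ∫ t, g t * u t := by
    refine continuous_iff_continuousAt.2 fun g => ?_
    refine LipschitzWith.continuous (K := K.toNNReal) ?_ |>.continuousAt
    refine LipschitzWith.of_dist_le_mul fun f g => ?_
    have hfi := L1.integrable_coeFn f
    have hgi := L1.integrable_coeFn g
    have hb : ∀ {f : ℝ → ℂ}, Integrable f → Integrable fun t => f t * u t := fun hf =>
      hf.mul_bdd (c := K) hu.aestronglyMeasurable (Eventually.of_forall hK)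
    rw [dist_eq_norm, ← integral_sub (hb hfi) (hb hgi), dist_eq_norm, L1.norm_eq_integral_norm,
      ← integral_const_mul]
    refine norm_integral_le_of_norm_le ((L1.integrable_coeFn _).norm.const_mul _) ?_
    filter_upwards [Lp.coeFn_sub f g] with t ht
    rw [ht, Pi.sub_apply, ← sub_mul, norm_mul, mul_comm]
    gcongr
    exact (hK t).trans (Real.le_coe_toNNReal K)
  have h2 : ∀ x : ℝ, ∫ t, ψ (-x + t) * u t =
      ∫ t, (DomAddAct.mk (-x) +ᵥ hm.toLp ψ : Lp ℂ 1 (volume : Measure ℝ)) t * u t := by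
    intro x
    refine integral_congr_ae ?_
    have hq := (measurePreserving_add_left (volume : Measure ℝ) (-x)).quasiMeasurePreserving
    have e1 := DomAddAct.vadd_Lp_ae_eq (DomAddAct.mk (-x)) (hm.toLp ψ)
    have e2 := hq.ae_eq_comp hm.coeFn_toLp
    filter_upwards [e1, e2] with t h1 h2
    rw [h1]
    exact congrArg (· * u t) h2.symm
  simp_rw [h2]
  have : Fact ((1 : ENNReal) ≠ ⊤) := ⟨ENNReal.one_ne_top⟩
  exact hL.comp ((DomAddAct.continuous_mk.comp continuous_neg).vadd continuous_const)

theorem integral_mul_eq_zero_of_periodic {ψ u : ℝ → ℂ} {K : ℝ} (hψ : Integrable ψ)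
    (hu : Measurable u) (hK : ∀ t, ‖u t‖ ≤ K) (hper : ∀ t, u (t + 2) = u t)
    (h1 : ∀ n : ℤ, 0 ≤ n → ∫ t, char2 n t * ψ t = 0)
    (h2 : ∀ m : ℤ, 0 < m → ∫ t in (-1 : ℝ)..1, char2 m t * u t = 0) :
    ∫ t, ψ t * u t = 0 := by
  set v : ℝ → ℂ := fun x => ∫ t, ψ t * u (t + x) with hv
  have hvc : Continuous v := continuous_integral_mul_comp_add hψ hu hK
  have hvp : Function.Periodic v 2 := by
    intro x
    simp only [hv, ← add_assoc, hper]
  have : Fact ((0 : ℝ) < 2) := ⟨two_pos⟩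
  have hlc : Continuous (hvp.lift) := by
    exact (QuotientAddGroup.isQuotientMap_mk _).continuous_iff.2 hvc
  set V : C(AddCircle (2 : ℝ), ℂ) := ⟨hvp.lift, hlc⟩ with hV
  have hcoef : ∀ n : ℤ, fourierCoeff V n = 0 := by
    intro n
    rw [fourierCoeff_eq_intervalIntegral V n 0]
    have e0 : ∀ x : ℝ, fourier (-n) (x : AddCircle (2 : ℝ)) • V x = char2 (-n) x * v x := by
      intro x
      rw [fourier_coe_apply, smul_eq_mul, char2]
      congr 1
      congr 1
      push_cast
      ring
    simp_rw [e0]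
    have e1 : ∀ x : ℝ, char2 (-n) x * v x = ∫ t, char2 (-n) x * (ψ t * u (t + x)) := by
      intro x
      rw [hv, integral_const_mul]
    simp_rw [e1]
    rw [intervalIntegral.integral_of_le (by norm_num), integral_integral_swap]
    · have e2 : ∀ t : ℝ, ∫ x in Ioc (0 : ℝ) (0 + 2), char2 (-n) x * (ψ t * u (t + x)) =
          (∫ y in (-1 : ℝ)..1, char2 (-n) y * u y) * (char2 n t * ψ t) := by
        intro t
        rw [← intervalIntegral.integral_of_le (by norm_num)]
        have : ∀ x : ℝ, char2 (-n) x * (ψ t * u (t + x)) =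
            (char2 (-n) (t + x) * u (t + x)) * (char2 n t * ψ t) := by
          intro x
          rw [char2_add]
          linear_combination (- char2 (-n) x * ψ t * u (t + x)) * char2_neg_mul n t
        simp_rw [this]
        rw [intervalIntegral.integral_mul_const,
          intervalIntegral.integral_comp_add_left (fun y => char2 (-n) y * u y)]
        congr 1
        have hp : Function.Periodic (fun y => char2 (-n) y * u y) 2 := by
          intro y
          simp only [hper, char2_add]
          have := char2_two_mul_int (-n) 1
          norm_num at this
          rw [this, mul_one]
        have := hp.intervalIntegral_add_eq t (-1)
        norm_num at this ⊢
        simpa [add_comm] using this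
      simp_rw [e2]
      rw [integral_const_mul]
      rcases le_or_gt 0 n with hn | hn
      · rw [h1 n hn]; simp
      · rw [h2 (-n) (by omega)]; simp
    · have hd : Integrable (fun z : ℝ × ℝ => K * ‖ψ z.2‖)
          ((volume.restrict (Ioc (0 : ℝ) (0 + 2))).prod volume) :=
        (integrable_const K).mul_prod hψ.norm
      refine hd.mono' ?_ (Eventually.of_forall fun z => ?_)
      · refine AEStronglyMeasurable.mul ?_ (AEStronglyMeasurable.mul hψ.1.comp_snd ?_)
        · exact ((continuous_char2 _).comp continuous_fst).aestronglyMeasurable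
        · exact (hu.comp (measurable_snd.add measurable_fst)).aestronglyMeasurable
      · simp only [Function.uncurry, norm_mul, norm_char2, one_mul]
        rw [mul_comm]
        gcongr
        exact hK _
  have hs : Summable (fourierCoeff V) := by
    rw [show fourierCoeff V = fun _ => 0 from funext hcoef]
    exact summable_zero
  have := has_pointwise_sum_fourier_series_of_summable hs ((0 : ℝ) : AddCircle (2 : ℝ))
  simp only [hcoef, zero_smul] at this
  have h0 := this.unique hasSum_zero
  have : v 0 = 0 := h0
  simpa [hv] using this

/-- The nonzero integers, indexing the inverse branches of the Gauss-type map `t ↦ -1/t mod 2`. -/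
abbrev NonzeroInt : Type := {k : ℤ // k ≠ 0}

/-- The inverse branches of the Gauss-type map `t ↦ -1/t mod 2` on `(-1, 1)`. -/
noncomputable def branch (k : ℤ) (t : ℝ) : ℝ := -(t + 2 * k)⁻¹

theorem two_mul_abs_sub_one_le {t : ℝ} (ht : t ∈ Ioo (-1 : ℝ) 1) (k : ℤ) :
    2 * |(k : ℝ)| - 1 ≤ |t + 2 * k| := by
  have h1 : |2 * (k : ℝ)| = 2 * |(k : ℝ)| := by rw [abs_mul, abs_two]
  have h2 : |2 * (k : ℝ)| ≤ |t + 2 * k| + |t| := by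
    have := abs_sub (t + 2 * (k : ℝ)) t
    simpa using this
  have h3 : |t| < 1 := abs_lt.2 ht
  linarith

theorem NonzeroInt.one_le_abs (k : NonzeroInt) : (1 : ℝ) ≤ |((k : ℤ) : ℝ)| := by
  exact_mod_cast Int.one_le_abs k.2

theorem one_lt_abs_add {t : ℝ} (ht : t ∈ Ioo (-1 : ℝ) 1) (k : NonzeroInt) :
    1 < |t + 2 * (k : ℤ)| := by
  have h1 : |2 * ((k : ℤ) : ℝ)| = 2 * |((k : ℤ) : ℝ)| := by rw [abs_mul, abs_two]
  have h2 : |2 * ((k : ℤ) : ℝ)| ≤ |t + 2 * (k : ℤ)| + |t| := by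
    have := abs_sub (t + 2 * ((k : ℤ) : ℝ)) t
    simpa using this
  have h3 : |t| < 1 := abs_lt.2 ht
  linarith [k.one_le_abs]

theorem one_lt_sq_add {t : ℝ} (ht : t ∈ Ioo (-1 : ℝ) 1) (k : NonzeroInt) :
    1 < (t + 2 * (k : ℤ)) ^ 2 := by
  have := one_lt_abs_add ht k
  rw [← sq_abs]
  nlinarith

theorem add_ne_zero_of_mem {t : ℝ} (ht : t ∈ Ioo (-1 : ℝ) 1) (k : NonzeroInt) :
    t + 2 * ((k : ℤ) : ℝ) ≠ 0 := by
  intro h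
  have := one_lt_sq_add ht k
  rw [h] at this
  norm_num at this

theorem branch_mem {t : ℝ} (ht : t ∈ Ioo (-1 : ℝ) 1) (k : NonzeroInt) :
    branch k t ∈ Ioo (-1 : ℝ) 1 := by
  refine abs_lt.1 ?_
  rw [branch, abs_neg, abs_inv]
  exact inv_lt_one_of_one_lt₀ (one_lt_abs_add ht k)

theorem abs_branch_le {t : ℝ} (ht : t ∈ Ioo (-1 : ℝ) 1) (k : NonzeroInt) :
    |branch k t| ≤ |((k : ℤ) : ℝ)|⁻¹ := by
  rw [branch, abs_neg, abs_inv]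
  have := two_mul_abs_sub_one_le ht k
  have := k.one_le_abs
  exact inv_anti₀ (by linarith) (by linarith)

theorem hasDerivAt_branch {t : ℝ} (ht : t ∈ Ioo (-1 : ℝ) 1) (k : NonzeroInt) :
    HasDerivAt (branch k) (1 / (t + 2 * (k : ℤ)) ^ 2) t := by
  have h := (((hasDerivAt_id t).add_const (2 * ((k : ℤ) : ℝ))).inv (add_ne_zero_of_mem ht k)).neg
  convert! h using 1
  simp [neg_div]

theorem measurable_branch (k : ℤ) : Measurable (branch k) := by
  unfold branch
  fun_prop

theorem branch_injective (k : ℤ) : Function.Injective (branch k) := by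
  intro s t h
  simpa [branch] using h

theorem lintegral_branch_image {A : Set ℝ} (hA : MeasurableSet A) (hAI : A ⊆ Ioo (-1) 1)
    (k : NonzeroInt) (B : ℝ → ENNReal) :
    ∫⁻ s in branch k '' A, B s =
      ∫⁻ t in A, ENNReal.ofReal (1 / (t + 2 * (k : ℤ)) ^ 2) * B (branch k t) := by
  rw [lintegral_image_eq_lintegral_abs_deriv_mul hA
    (fun t ht => (hasDerivAt_branch (hAI ht) k).hasDerivWithinAt) (branch_injective k).injOn]
  refine lintegral_congr fun t => ?_
  rw [abs_of_nonneg (by positivity)]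

theorem tsum_lintegral_branch_image_le (B : ℝ → ENNReal) :
    ∑' k : NonzeroInt, ∫⁻ s in branch k '' Ioo (-1) 1, B s ≤ ∫⁻ s in Ioo (-1 : ℝ) 1, B s := by
  rw [← lintegral_iUnion]
  · refine lintegral_mono_set ?_
    rintro _ ⟨_, ⟨k, rfl⟩, t, ht, rfl⟩
    exact branch_mem ht k
  · exact fun k => measurableSet_Ioo.image_of_measurable_injOn (measurable_branch k)
      (branch_injective k).injOn
  · intro k l hkl
    refine disjoint_left.2 ?_
    rintro _ ⟨t, ht, rfl⟩ ⟨s, hs, h⟩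
    apply hkl
    rw [branch, branch, neg_inj, inv_inj] at h
    have h1 : |((k : ℤ) : ℝ) - (l : ℤ)| < 1 := by
      rw [abs_lt]
      constructor <;> linarith [ht.1, ht.2, hs.1, hs.2]
    have h2 : |(k : ℤ) - (l : ℤ)| < 1 := by exact_mod_cast h1
    exact Subtype.ext (by rw [Int.abs_lt_one_iff] at h2; omega)

theorem lintegral_transfer_le {B : ℝ → ENNReal} (hB : Measurable B) :
    ∫⁻ t in Ioo (-1 : ℝ) 1, ∑' k : NonzeroInt,
      ENNReal.ofReal (1 / (t + 2 * (k : ℤ)) ^ 2) * B (branch k t) ≤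
      ∫⁻ s in Ioo (-1 : ℝ) 1, B s := by
  refine le_trans (le_of_eq ?_) (tsum_lintegral_branch_image_le B)
  rw [lintegral_tsum]
  · exact tsum_congr fun k => (lintegral_branch_image measurableSet_Ioo subset_rfl k B).symm
  · intro k
    exact ((Measurable.ennreal_ofReal (by fun_prop)).mul
      (hB.comp (measurable_branch k))).aemeasurable

/-- Transition weights of the Gauss-type map relative to its invariant density `1 / (1 - t²)`. -/
noncomputable def weight (k : ℤ) (t : ℝ) : ℝ :=
  if t ∈ Ioo (-1 : ℝ) 1 then (1 - t ^ 2) / ((t + 2 * k) ^ 2 - 1) else 0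

theorem one_sub_sq_pos {t : ℝ} (ht : t ∈ Ioo (-1 : ℝ) 1) : 0 < 1 - t ^ 2 := by
  nlinarith [ht.1, ht.2]

theorem weight_of_mem {t : ℝ} (ht : t ∈ Ioo (-1 : ℝ) 1) (k : ℤ) :
    weight k t = (1 - t ^ 2) / ((t + 2 * k) ^ 2 - 1) := if_pos ht

theorem weight_nonneg (k : NonzeroInt) (t : ℝ) : 0 ≤ weight k t := by
  unfold weight
  split_ifs with ht
  · exact div_nonneg (one_sub_sq_pos ht).le (by linarith [one_lt_sq_add ht k])
  · exact le_rfl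

theorem measurable_weight (k : ℤ) : Measurable (weight k) := by
  unfold weight
  exact Measurable.ite measurableSet_Ioo (by fun_prop) measurable_const

theorem hasSum_telescope {t : ℝ} (ht : t ∈ Ioo (-1 : ℝ) 1) :
    HasSum (fun n : ℕ => 1 / ((t + 2 * ((n : ℝ) + 1)) ^ 2 - 1)) (1 / 2 * (1 / (1 + t))) := by
  have hpos : ∀ n : ℕ, 0 < t + 2 * (n : ℝ) + 1 := fun n => by
    have : (0 : ℝ) ≤ n := by positivity
    linarith [ht.1]
  have hterm : ∀ n : ℕ, 1 / ((t + 2 * ((n : ℝ) + 1)) ^ 2 - 1) =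
      1 / 2 * (1 / (t + 2 * (n : ℝ) + 1)) - 1 / 2 * (1 / (t + 2 * ((n + 1 : ℕ) : ℝ) + 1)) := by
    intro n
    have h1 := hpos n
    have h2 := hpos (n + 1)
    have h3 : (t + 2 * ((n : ℝ) + 1)) ^ 2 - 1 =
        (t + 2 * (n : ℝ) + 1) * (t + 2 * ((n + 1 : ℕ) : ℝ) + 1) := by push_cast; ring
    rw [h3]
    field_simp
    push_cast
    ring
  rw [hasSum_iff_tendsto_nat_of_nonneg]
  · simp_rw [hterm]
    simp_rw [Finset.sum_range_sub' (fun n : ℕ => 1 / 2 * (1 / (t + 2 * (n : ℝ) + 1)))]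
    have : Tendsto (fun n : ℕ => 1 / 2 * (1 / (t + 2 * (n : ℝ) + 1))) atTop (𝓝 (1 / 2 * 0)) := by
      refine Tendsto.const_mul _ ?_
      simp_rw [one_div]
      refine tendsto_inv_atTop_zero.comp ?_
      refine tendsto_atTop_add_const_right _ _ (tendsto_atTop_add_const_left _ _ ?_)
      exact tendsto_natCast_atTop_atTop.const_mul_atTop two_pos
    have := this.const_sub (1 / 2 * (1 / (t + 2 * ((0 : ℕ) : ℝ) + 1)))
    convert! this using 2
    simp [add_comm]
  · intro n
    rw [hterm, sub_nonneg]
    have := hpos n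
    gcongr
    simp

theorem hasSum_weight {t : ℝ} (ht : t ∈ Ioo (-1 : ℝ) 1) :
    HasSum (fun k : NonzeroInt => weight k t) 1 := by
  have ht' : -t ∈ Ioo (-1 : ℝ) 1 := ⟨by linarith [ht.2], by linarith [ht.1]⟩
  set f : ℤ → ℝ := fun k => 1 / ((t + 2 * k) ^ 2 - 1) with hf
  have hneg : HasSum (fun n : ℕ => ({0}ᶜ : Set ℤ).indicator f (-(n + 1 : ℤ)))
      (1 / 2 * (1 / (1 - t))) := by
    convert! hasSum_telescope ht' using 2 with n
    · rw [indicator_of_mem (by simp; omega)]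
      simp only [hf]
      push_cast
      congr 2
      ring
  have hpos : HasSum (fun n : ℕ => ({0}ᶜ : Set ℤ).indicator f n) (1 / 2 * (1 / (1 + t))) := by
    have h0 : HasSum (fun n : ℕ => ({0}ᶜ : Set ℤ).indicator f ((n + 1 : ℕ) : ℤ))
        (1 / 2 * (1 / (1 + t))) := by
      convert! hasSum_telescope ht using 2 with n
      rw [indicator_of_mem (by simp; omega)]
      simp only [hf]
      push_cast
      rfl
    refine (hasSum_nat_add_iff' (f := fun n : ℕ => ({0}ᶜ : Set ℤ).indicator f n) 1).1 ?_
    simpa using h0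
  have h := hpos.of_nat_of_neg_add_one hneg
  rw [← hasSum_subtype_iff_indicator] at h
  have h2 := h.mul_left (1 - t ^ 2)
  convert! h2 using 1
  · funext k
    simp only [Function.comp, hf]
    rw [weight_of_mem ht]
    ring
  · have := one_sub_sq_pos ht
    have h3 : 1 + t ≠ 0 := by linarith [ht.1]
    have h4 : 1 - t ≠ 0 := by linarith [ht.2]
    field_simp
    ring

theorem summable_weight (t : ℝ) : Summable fun k : NonzeroInt => weight k t := by
  by_cases ht : t ∈ Ioo (-1 : ℝ) 1
  · exact (hasSum_weight ht).summable
  · have hw : ∀ k, weight k t = 0 := fun k => if_neg ht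
    simp only [hw, summable_zero]

/-- The density of the `n`-th iterate of the transfer operator applied to `1`, relative to the
invariant density `1 / (1 - t²)`. -/
noncomputable def relDensity : ℕ → ℝ → ℝ
  | 0 => fun t => if t ∈ Ioo (-1 : ℝ) 1 then 1 - t ^ 2 else 0
  | n + 1 => fun t => ∑' k : NonzeroInt, weight k t * relDensity n (branch k t)

theorem relDensity_zero {t : ℝ} (ht : t ∈ Ioo (-1 : ℝ) 1) : relDensity 0 t = 1 - t ^ 2 := if_pos ht

theorem relDensity_succ (n : ℕ) (t : ℝ) :
    relDensity (n + 1) t = ∑' k : NonzeroInt, weight k t * relDensity n (branch k t) := rfl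

theorem relDensity_mem (n : ℕ) (t : ℝ) : relDensity n t ∈ Icc (0 : ℝ) 1 := by
  induction n generalizing t with
  | zero =>
    unfold relDensity
    split_ifs with ht
    · exact ⟨(one_sub_sq_pos ht).le, by nlinarith⟩
    · simp
  | succ n ih =>
    rw [relDensity_succ]
    refine ⟨tsum_nonneg fun k => mul_nonneg (weight_nonneg k t) (ih _).1, ?_⟩
    by_cases ht : t ∈ Ioo (-1 : ℝ) 1
    · rw [← (hasSum_weight ht).tsum_eq]
      have hle : ∀ k : NonzeroInt, weight k t * relDensity n (branch k t) ≤ weight k t :=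
        fun k => mul_le_of_le_one_right (weight_nonneg k t) (ih _).2
      exact (Summable.of_nonneg_of_le (fun k => mul_nonneg (weight_nonneg k t) (ih _).1) hle
        (summable_weight t)).tsum_le_tsum hle (summable_weight t)
    · have hw : ∀ k, weight k t = 0 := fun k => if_neg ht
      simp [hw]

theorem summable_weight_mul {ρ : NonzeroInt → ℝ} (hρ : ∀ k, ρ k ∈ Icc (0 : ℝ) 1) (t : ℝ) :
    Summable fun k : NonzeroInt => weight k t * ρ k :=
  Summable.of_nonneg_of_le (fun k => mul_nonneg (weight_nonneg k t) (hρ k).1)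
    (fun k => mul_le_of_le_one_right (weight_nonneg k t) (hρ k).2) (summable_weight t)

theorem summable_relDensity (n : ℕ) (t : ℝ) :
    Summable fun k : NonzeroInt => weight k t * relDensity n (branch k t) :=
  summable_weight_mul (fun _ => relDensity_mem n _) t

theorem measurable_relDensity (n : ℕ) : Measurable (relDensity n) := by
  induction n with
  | zero => exact Measurable.ite measurableSet_Ioo (by fun_prop) measurable_const
  | succ n ih =>
    have h : relDensity (n + 1) = fun t => (∑' k : NonzeroInt,
        ENNReal.ofReal (weight k t * relDensity n (branch k t))).toReal := by
      funext t
      have h0 : ∀ k : NonzeroInt, 0 ≤ weight k t * relDensity n (branch k t) :=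
        fun k => mul_nonneg (weight_nonneg k t) (relDensity_mem n _).1
      rw [← ENNReal.ofReal_tsum_of_nonneg h0 (summable_relDensity n t),
        ENNReal.toReal_ofReal (tsum_nonneg h0), relDensity_succ]
    rw [h]
    refine (Measurable.tsum fun k => ?_).ennreal_toReal
    exact ((measurable_weight k).mul (ih.comp (measurable_branch k))).ennreal_ofReal

theorem NonzeroInt.neg_ne_zero (k : NonzeroInt) : -(k : ℤ) ≠ 0 := _root_.neg_ne_zero.2 k.2

theorem neg_mem_Ioo {t : ℝ} (ht : t ∈ Ioo (-1 : ℝ) 1) : -t ∈ Ioo (-1 : ℝ) 1 :=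
  ⟨by linarith [ht.2], by linarith [ht.1]⟩

theorem branch_neg (k : ℤ) (t : ℝ) : branch (-k) (-t) = -branch k t := by
  unfold branch
  push_cast
  rw [← inv_neg]
  ring

theorem weight_neg (k : ℤ) (t : ℝ) : weight (-k) (-t) = weight k t := by
  by_cases ht : t ∈ Ioo (-1 : ℝ) 1
  · rw [weight_of_mem ht, weight_of_mem (neg_mem_Ioo ht)]
    push_cast
    congr 1 <;> ring
  · have ht' : -t ∉ Ioo (-1 : ℝ) 1 := fun h => ht (by simpa using neg_mem_Ioo h)
    rw [weight, weight, if_neg ht, if_neg ht']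

theorem relDensity_neg (n : ℕ) (t : ℝ) : relDensity n (-t) = relDensity n t := by
  induction n generalizing t with
  | zero =>
    by_cases ht : t ∈ Ioo (-1 : ℝ) 1
    · rw [relDensity_zero ht, relDensity_zero (neg_mem_Ioo ht)]
      ring
    · have ht' : -t ∉ Ioo (-1 : ℝ) 1 := fun h => ht (by simpa using neg_mem_Ioo h)
      unfold relDensity
      rw [if_neg ht, if_neg ht']
  | succ n ih =>
    rw [relDensity_succ, relDensity_succ]
    let e : NonzeroInt ≃ NonzeroInt :=
      { toFun := fun k => ⟨-k, k.neg_ne_zero⟩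
        invFun := fun k => ⟨-k, k.neg_ne_zero⟩
        left_inv := fun k => by simp
        right_inv := fun k => by simp }
    rw [← e.tsum_eq]
    refine tsum_congr fun k => ?_
    change weight (-k) (-t) * relDensity n (branch (-k) (-t)) = _
    rw [weight_neg, branch_neg, ih]

theorem one_sub_branch_sq {t : ℝ} (ht : t ∈ Ioo (-1 : ℝ) 1) (k : NonzeroInt) :
    1 - branch k t ^ 2 = ((t + 2 * (k : ℤ)) ^ 2 - 1) / (t + 2 * (k : ℤ)) ^ 2 := by
  have := add_ne_zero_of_mem ht k
  unfold branch
  field_simp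

/-- The density of the `n`-th iterate of the transfer operator applied to `1`. -/
noncomputable def transferDensity (n : ℕ) (t : ℝ) : ENNReal :=
  ENNReal.ofReal (relDensity n t / (1 - t ^ 2))

theorem measurable_transferDensity (n : ℕ) : Measurable (transferDensity n) :=
  ((measurable_relDensity n).div (by fun_prop)).ennreal_ofReal

theorem transferDensity_succ (n : ℕ) {t : ℝ} (ht : t ∈ Ioo (-1 : ℝ) 1) :
    transferDensity (n + 1) t = ∑' k : NonzeroInt,
      ENNReal.ofReal (1 / (t + 2 * (k : ℤ)) ^ 2) * transferDensity n (branch k t) := by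
  have h0 := one_sub_sq_pos ht
  rw [transferDensity, relDensity_succ, ← tsum_div_const, ENNReal.ofReal_tsum_of_nonneg]
  · refine tsum_congr fun k => ?_
    rw [transferDensity, ← ENNReal.ofReal_mul (by positivity), weight_of_mem ht,
      one_sub_branch_sq ht]
    congr 1
    have h1 := add_ne_zero_of_mem ht k
    have h2 : (t + 2 * ((k : ℤ) : ℝ)) ^ 2 - 1 ≠ 0 := by linarith [one_lt_sq_add ht k]
    field_simp
  · exact fun k => div_nonneg (mul_nonneg (weight_nonneg k t) (relDensity_mem n _).1) h0.le
  · exact (summable_relDensity n t).div_const _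

theorem transferDensity_le (n : ℕ) {t : ℝ} (ht : t ∈ Ioo (-1 : ℝ) 1) :
    transferDensity n t ≤ ENNReal.ofReal (1 / (1 - t ^ 2)) := by
  have h0 := one_sub_sq_pos ht
  refine ENNReal.ofReal_le_ofReal ?_
  gcongr
  exact (relDensity_mem n t).2

theorem lintegral_transferDensity_le (n : ℕ) :
    ∫⁻ t in Ioo (-1 : ℝ) 1, transferDensity n t ≤ 2 := by
  induction n with
  | zero =>
    rw [setLIntegral_congr_fun (g := fun _ => 1) measurableSet_Ioo]
    · simp only [setLIntegral_const, Real.volume_Ioo, one_mul]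
      norm_num
    · intro t ht
      have h0 := one_sub_sq_pos ht
      simp only [transferDensity, relDensity_zero ht, div_self h0.ne', ENNReal.ofReal_one]
  | succ n ih =>
    rw [setLIntegral_congr_fun measurableSet_Ioo (fun t ht => transferDensity_succ n ht)]
    exact (lintegral_transfer_le (measurable_transferDensity n)).trans ih

theorem branch_monotoneOn (k : NonzeroInt) : MonotoneOn (branch k) (Ioo (-1) 1) := by
  intro s hs t ht hst
  have h1 := add_ne_zero_of_mem hs k
  have h2 := add_ne_zero_of_mem ht k
  have h3 : 0 < (s + 2 * ((k : ℤ) : ℝ)) * (t + 2 * (k : ℤ)) := by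
    have hk := k.2
    rcases lt_or_gt_of_ne hk with h | h
    · have : ((k : ℤ) : ℝ) ≤ -1 := by exact_mod_cast (by omega : (k : ℤ) ≤ -1)
      exact mul_pos_of_neg_of_neg (by linarith [hs.2]) (by linarith [ht.2])
    · have : (1 : ℝ) ≤ ((k : ℤ) : ℝ) := by exact_mod_cast (by omega : 1 ≤ (k : ℤ))
      exact mul_pos (by linarith [hs.1]) (by linarith [ht.1])
  have h4 : branch k t - branch k s = (t - s) / ((s + 2 * ((k : ℤ) : ℝ)) * (t + 2 * (k : ℤ))) := by
    unfold branch
    field_simp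
    ring
  have : 0 ≤ branch k t - branch k s := h4 ▸ div_nonneg (by linarith) h3.le
  linarith

theorem sq_div_le_sq_div {s t : ℝ} (hs : s ∈ Ioo (-1 : ℝ) 1) (ht : t ∈ Ioo (-1 : ℝ) 1)
    (hst : s ≤ t) (k : NonzeroInt) :
    ((1 - t) / (t + 2 * (k : ℤ) + 1)) ^ 2 ≤ ((1 - s) / (s + 2 * (k : ℤ) + 1)) ^ 2 := by
  rcases lt_or_gt_of_ne k.2 with h | h
  · have hk : ((k : ℤ) : ℝ) ≤ -1 := by exact_mod_cast (by omega : (k : ℤ) ≤ -1)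
    have h1 : 0 < -(t + 2 * ((k : ℤ) : ℝ) + 1) := by linarith [ht.2]
    have h2 : 0 < -(s + 2 * ((k : ℤ) : ℝ) + 1) := by linarith [hs.2]
    rw [← neg_sq, ← neg_sq ((1 - s) / _), ← div_neg, ← div_neg]
    refine pow_le_pow_left₀ (div_nonneg (by linarith [ht.2]) h1.le) ?_ 2
    rw [div_le_div_iff₀ h1 h2]
    nlinarith
  · have hk : (1 : ℝ) ≤ ((k : ℤ) : ℝ) := by exact_mod_cast (by omega : 1 ≤ (k : ℤ))
    have h1 : 0 < t + 2 * ((k : ℤ) : ℝ) + 1 := by linarith [ht.1]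
    have h2 : 0 < s + 2 * ((k : ℤ) : ℝ) + 1 := by linarith [hs.1]
    refine pow_le_pow_left₀ (div_nonneg (by linarith [ht.2]) h1.le) ?_ 2
    rw [div_le_div_iff₀ h1 h2]
    nlinarith

theorem relDensity_mul_antitoneOn (n : ℕ) :
    AntitoneOn (fun t => relDensity n t * ((1 - t) / (1 + t))) (Ioo (-1) 1) := by
  induction n with
  | zero =>
    intro s hs t ht hst
    have h : ∀ u ∈ Ioo (-1 : ℝ) 1, relDensity 0 u * ((1 - u) / (1 + u)) = (1 - u) ^ 2 := by
      intro u hu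
      have : 1 + u ≠ 0 := by linarith [hu.1]
      rw [relDensity_zero hu]
      field_simp
      ring
    simp only
    rw [h s hs, h t ht]
    nlinarith [ht.2]
  | succ n ih =>
    have hterm : ∀ u ∈ Ioo (-1 : ℝ) 1, ∀ k : NonzeroInt,
        weight k u * relDensity n (branch k u) * ((1 - u) / (1 + u)) =
        relDensity n (branch k u) * ((1 - branch k u) / (1 + branch k u)) *
          ((1 - u) / (u + 2 * (k : ℤ) + 1)) ^ 2 := by
      intro u hu k
      have h1 : 1 + u ≠ 0 := by linarith [hu.1]
      have h2 := add_ne_zero_of_mem hu k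
      have h3 := one_lt_sq_add hu k
      have h4 : u + 2 * ((k : ℤ) : ℝ) + 1 ≠ 0 := fun h => by
        rw [eq_neg_of_add_eq_zero_left h] at h3
        norm_num at h3
      have h5 : u + 2 * ((k : ℤ) : ℝ) - 1 ≠ 0 := fun h => by
        rw [sub_eq_zero.1 h] at h3
        norm_num at h3
      have h6 : (1 - branch k u) / (1 + branch k u) =
          (u + 2 * ((k : ℤ) : ℝ) + 1) / (u + 2 * ((k : ℤ) : ℝ) - 1) := by
        have h7 : 1 - branch k u = (u + 2 * ((k : ℤ) : ℝ) + 1) / (u + 2 * ((k : ℤ) : ℝ)) := by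
          unfold branch
          field_simp
          ring
        have h8 : 1 + branch k u = (u + 2 * ((k : ℤ) : ℝ) - 1) / (u + 2 * ((k : ℤ) : ℝ)) := by
          unfold branch
          field_simp
          ring
        rw [h7, h8]
        field_simp
      have h9 : (u + 2 * ((k : ℤ) : ℝ)) ^ 2 - 1 =
          (u + 2 * ((k : ℤ) : ℝ) + 1) * (u + 2 * ((k : ℤ) : ℝ) - 1) := by ring
      rw [h6, weight_of_mem hu, h9]
      field_simp
      ring
    intro s hs t ht hst
    simp only [relDensity_succ]
    rw [← tsum_mul_right, ← tsum_mul_right]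
    refine Summable.tsum_le_tsum (fun k => ?_) ((summable_relDensity n t).mul_right _)
      ((summable_relDensity n s).mul_right _)
    rw [hterm s hs, hterm t ht]
    have hb := branch_mem hs k
    have hmono := ih hb (branch_mem ht k) (branch_monotoneOn k hs ht hst)
    refine mul_le_mul hmono (sq_div_le_sq_div hs ht hst k) (sq_nonneg _) ?_
    exact mul_nonneg (relDensity_mem n _).1
      (div_nonneg (by linarith [hb.2]) (by linarith [hb.1]))

theorem abs_relDensity_sub_le (n : ℕ) {s : ℝ} (hs : |s| ≤ 1 / 2) :
    |relDensity n s - relDensity n 0| ≤ 4 * |s| := by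
  wlog h0 : 0 ≤ s generalizing s
  · have := this (s := -s) (by rwa [abs_neg]) (by linarith)
    rwa [relDensity_neg, abs_neg] at this
  rw [abs_of_nonneg h0] at hs ⊢
  have hz : (0 : ℝ) ∈ Ioo (-1 : ℝ) 1 := by norm_num
  have hs1 : s ∈ Ioo (-1 : ℝ) 1 := ⟨by linarith, by linarith⟩
  have h1 := relDensity_mul_antitoneOn n hz hs1 h0
  have h2 := relDensity_mul_antitoneOn n (neg_mem_Ioo hs1) hz (by linarith)
  simp only [relDensity_neg] at h1 h2
  have h3 := relDensity_mem n 0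
  have h4 := relDensity_mem n s
  rw [← mul_div_assoc, ← mul_div_assoc, div_le_div_iff₀ (by linarith) (by linarith)] at h1 h2
  rw [abs_le]
  constructor <;> nlinarith [h3.1, h3.2, h4.1, h4.2]

/-- The variance of `relDensity n` over the preimages of `t`, relative to the invariant density. -/
noncomputable def preimageVariance (n : ℕ) (t : ℝ) : ENNReal :=
  ∑' k : NonzeroInt, ENNReal.ofReal
    ((relDensity n (branch k t) - relDensity (n + 1) t) ^ 2 / ((t + 2 * (k : ℤ)) ^ 2 - 1))

theorem measurable_preimageVariance (n : ℕ) : Measurable (preimageVariance n) :=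
  Measurable.tsum fun k => ((((measurable_relDensity n).comp (measurable_branch k)).sub
    (measurable_relDensity (n + 1))).pow_const 2 |>.div (by fun_prop)).ennreal_ofReal

/-- The energy density of `relDensity n` relative to the invariant density. -/
noncomputable def energyDensity (n : ℕ) (t : ℝ) : ENNReal :=
  ENNReal.ofReal (relDensity n t ^ 2 / (1 - t ^ 2))

theorem measurable_energyDensity (n : ℕ) : Measurable (energyDensity n) :=
  (((measurable_relDensity n).pow_const 2).div (by fun_prop)).ennreal_ofReal

theorem preimageVariance_add_energyDensity (n : ℕ) {t : ℝ} (ht : t ∈ Ioo (-1 : ℝ) 1) :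
    preimageVariance n t + energyDensity (n + 1) t = ∑' k : NonzeroInt,
      ENNReal.ofReal (1 / (t + 2 * (k : ℤ)) ^ 2) * energyDensity n (branch k t) := by
  have h0 := one_sub_sq_pos ht
  set m := relDensity (n + 1) t with hm
  have hsum : HasSum (fun k : NonzeroInt => weight k t * relDensity n (branch k t)) m :=
    (summable_relDensity n t).hasSum
  have hsq : Summable fun k : NonzeroInt => weight k t * relDensity n (branch k t) ^ 2 :=
    summable_weight_mul (fun k => ⟨sq_nonneg _, pow_le_one₀ (relDensity_mem n _).1
      (relDensity_mem n _).2⟩) t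
  have hvar : HasSum (fun k : NonzeroInt =>
      (relDensity n (branch k t) - m) ^ 2 / ((t + 2 * (k : ℤ)) ^ 2 - 1))
      (((∑' k : NonzeroInt, weight k t * relDensity n (branch k t) ^ 2) - m ^ 2) /
        (1 - t ^ 2)) := by
    have := (((hsq.hasSum.sub (hsum.mul_left (2 * m))).add
      ((hasSum_weight ht).mul_left (m ^ 2))).div_const (1 - t ^ 2))
    convert! this using 1
    · funext k
      have h2 : (t + 2 * ((k : ℤ) : ℝ)) ^ 2 - 1 ≠ 0 := by linarith [one_lt_sq_add ht k]
      rw [weight_of_mem ht]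
      field_simp
      ring
    · congr 1
      ring
  have hX : preimageVariance n t = ENNReal.ofReal
      (((∑' k : NonzeroInt, weight k t * relDensity n (branch k t) ^ 2) - m ^ 2) /
        (1 - t ^ 2)) := by
    rw [preimageVariance, ← hvar.tsum_eq, ENNReal.ofReal_tsum_of_nonneg _ hvar.summable]
    intro k
    exact div_nonneg (sq_nonneg _) (by linarith [one_lt_sq_add ht k])
  have hnn : 0 ≤ ((∑' k : NonzeroInt, weight k t * relDensity n (branch k t) ^ 2) - m ^ 2) /
        (1 - t ^ 2) := hvar.nonneg fun k =>
    div_nonneg (sq_nonneg _) (by linarith [one_lt_sq_add ht k])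
  rw [hX, energyDensity, ← hm, ← ENNReal.ofReal_add hnn (div_nonneg (sq_nonneg _) h0.le),
    ← add_div, sub_add_cancel, ← tsum_div_const, ENNReal.ofReal_tsum_of_nonneg]
  · refine tsum_congr fun k => ?_
    rw [energyDensity, ← ENNReal.ofReal_mul (by positivity), weight_of_mem ht,
      one_sub_branch_sq ht]
    congr 1
    have h1 := add_ne_zero_of_mem ht k
    have h2 : (t + 2 * ((k : ℤ) : ℝ)) ^ 2 - 1 ≠ 0 := by linarith [one_lt_sq_add ht k]
    field_simp
  · exact fun k => div_nonneg (mul_nonneg (weight_nonneg k t) (sq_nonneg _)) h0.le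
  · exact hsq.div_const _

theorem lintegral_preimageVariance_add_le (n : ℕ) :
    (∫⁻ t in Ioo (-1 : ℝ) 1, preimageVariance n t) +
      ∫⁻ t in Ioo (-1 : ℝ) 1, energyDensity (n + 1) t ≤
      ∫⁻ t in Ioo (-1 : ℝ) 1, energyDensity n t := by
  rw [← lintegral_add_left (measurable_preimageVariance n),
    setLIntegral_congr_fun measurableSet_Ioo
      (fun t ht => preimageVariance_add_energyDensity n ht)]
  exact lintegral_transfer_le (measurable_energyDensity n)

theorem tsum_lintegral_preimageVariance_le :
    ∑' n, ∫⁻ t in Ioo (-1 : ℝ) 1, preimageVariance n t ≤ 2 := by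
  have h0 : ∫⁻ t in Ioo (-1 : ℝ) 1, energyDensity 0 t ≤ 2 := by
    refine le_trans (setLIntegral_mono (g := transferDensity 0)
      (measurable_transferDensity 0) fun t ht => ENNReal.ofReal_le_ofReal ?_)
      (lintegral_transferDensity_le 0)
    have := one_sub_sq_pos ht
    have := relDensity_mem 0 t
    gcongr
    nlinarith [this.1, this.2]
  have hN : ∀ N : ℕ, (∑ n ∈ Finset.range N, ∫⁻ t in Ioo (-1 : ℝ) 1, preimageVariance n t) +
      ∫⁻ t in Ioo (-1 : ℝ) 1, energyDensity N t ≤ 2 := by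
    intro N
    induction N with
    | zero => simpa using h0
    | succ N ih =>
      rw [Finset.sum_range_succ, add_assoc]
      exact (add_le_add_right (lintegral_preimageVariance_add_le N) _).trans ih
  exact ENNReal.tsum_le_of_sum_range_le fun N => le_self_add.trans (hN N)

theorem ae_tendsto_relDensity_branch_sub : ∀ᵐ t ∂volume.restrict (Ioo (-1 : ℝ) 1),
    ∀ k : NonzeroInt,
      Tendsto (fun n => relDensity n (branch k t) - relDensity (n + 1) t) atTop (𝓝 0) := by
  have h : ∫⁻ t in Ioo (-1 : ℝ) 1, ∑' n, preimageVariance n t ≠ ⊤ := by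
    rw [lintegral_tsum fun n => (measurable_preimageVariance n).aemeasurable]
    exact ne_top_of_le_ne_top (by norm_num) tsum_lintegral_preimageVariance_le
  filter_upwards [ae_lt_top (Measurable.tsum measurable_preimageVariance) h,
    ae_restrict_mem measurableSet_Ioo] with t hfin ht k
  have hX := ENNReal.tendsto_atTop_zero_of_tsum_ne_top hfin.ne
  have hd : 0 < (t + 2 * ((k : ℤ) : ℝ)) ^ 2 - 1 := by linarith [one_lt_sq_add ht k]
  have h1 : Tendsto (fun n => ENNReal.ofReal
      ((relDensity n (branch k t) - relDensity (n + 1) t) ^ 2 / ((t + 2 * (k : ℤ)) ^ 2 - 1)))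
      atTop (𝓝 0) :=
    tendsto_of_tendsto_of_tendsto_of_le_of_le tendsto_const_nhds hX (fun _ => zero_le)
      fun n => ENNReal.le_tsum (f := fun k : NonzeroInt => ENNReal.ofReal
        ((relDensity n (branch k t) - relDensity (n + 1) t) ^ 2 /
          ((t + 2 * (k : ℤ)) ^ 2 - 1))) k
  have h2 := (ENNReal.tendsto_toReal ENNReal.zero_ne_top).comp h1
  have h3 := (h2.mul_const ((t + 2 * ((k : ℤ) : ℝ)) ^ 2 - 1)).sqrt
  rw [tendsto_zero_iff_abs_tendsto_zero]
  convert! h3 using 2 with n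
  · simp only [Function.comp]
    rw [ENNReal.toReal_ofReal (div_nonneg (sq_nonneg _) hd.le), div_mul_cancel₀ _ hd.ne',
      Real.sqrt_sq_eq_abs]
  · simp

theorem ae_tendsto_relDensity_sub_zero : ∀ᵐ t ∂volume.restrict (Ioo (-1 : ℝ) 1),
    Tendsto (fun n => relDensity (n + 1) t - relDensity n 0) atTop (𝓝 0) := by
  filter_upwards [ae_tendsto_relDensity_branch_sub, ae_restrict_mem measurableSet_Ioo]
    with t h ht
  rw [Metric.tendsto_atTop]
  intro ε hε
  obtain ⟨K, hK⟩ := exists_nat_gt (8 / ε + 2)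
  have hK0 : (0 : ℝ) < K := lt_trans (by positivity) hK
  have hKz : (K : ℤ) ≠ 0 := by
    have : K ≠ 0 := by
      rintro rfl
      simp at hK0
    exact_mod_cast this
  obtain ⟨N, hN⟩ := Metric.tendsto_atTop.1 (h ⟨K, hKz⟩) (ε / 2) (by positivity)
  refine ⟨N, fun n hn => ?_⟩
  have h1 := hN n hn
  rw [Real.dist_eq, sub_zero] at h1 ⊢
  simp only at h1
  have h2 : |branch K t| ≤ (K : ℝ)⁻¹ := by
    have := abs_branch_le ht ⟨K, hKz⟩
    simpa using this
  have h3 : (K : ℝ)⁻¹ ≤ 1 / 2 := by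
    rw [inv_le_comm₀ hK0 (by norm_num)]
    have : 0 < 8 / ε := by positivity
    linarith
  have h4 := abs_relDensity_sub_le n (h2.trans h3)
  have h5 : 4 * (K : ℝ)⁻¹ < ε / 2 := by
    rw [← div_eq_mul_inv, div_lt_iff₀ hK0]
    have : 8 / ε < K := by linarith
    rw [div_lt_iff₀ hε] at this
    linarith
  rw [abs_le] at h4
  rw [abs_lt] at h1 ⊢
  constructor <;> linarith [h4.1, h4.2, h1.1, h1.2]

theorem exists_le_intervalIntegral_one_div_one_sub_sq (M : ℝ) : ∃ s : ℝ, 0 < s ∧ s < 1 ∧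
    M ≤ ∫ t in (0 : ℝ)..s, 1 / (1 - t ^ 2) := by
  refine ⟨1 - Real.exp (-(2 * |M| + 1)), ?_, ?_, ?_⟩
  · rw [sub_pos, Real.exp_lt_one_iff]
    linarith [abs_nonneg M]
  · linarith [Real.exp_pos (-(2 * |M| + 1))]
  · set s := 1 - Real.exp (-(2 * |M| + 1)) with hs
    have hs0 : 0 < s := by
      rw [hs, sub_pos, Real.exp_lt_one_iff]
      linarith [abs_nonneg M]
    have hs1 : s < 1 := by linarith [Real.exp_pos (-(2 * |M| + 1))]
    have hlog : ∫ t in (0 : ℝ)..s, 1 / 2 * (1 - t)⁻¹ = 1 / 2 * (2 * |M| + 1) := by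
      rw [intervalIntegral.integral_const_mul, intervalIntegral.integral_comp_sub_left
        (fun t => t⁻¹), integral_inv_of_pos (by linarith) (by norm_num)]
      rw [sub_zero, Real.log_div one_ne_zero (by linarith), Real.log_one, hs]
      simp
    have hle : ∫ t in (0 : ℝ)..s, 1 / 2 * (1 - t)⁻¹ ≤ ∫ t in (0 : ℝ)..s, 1 / (1 - t ^ 2) := by
      refine intervalIntegral.integral_mono_on hs0.le ?_ ?_ ?_
      · refine ContinuousOn.intervalIntegrable ?_
        rw [uIcc_of_le hs0.le]
        refine continuousOn_const.mul (ContinuousOn.inv₀ (by fun_prop) fun t ht => ?_)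
        linarith [ht.2]
      · refine ContinuousOn.intervalIntegrable ?_
        rw [uIcc_of_le hs0.le]
        refine continuousOn_const.div (by fun_prop) fun t ht => ?_
        nlinarith [ht.1, ht.2]
      · intro t ht
        have h1 : 0 < 1 - t := by linarith [ht.2]
        have h2 : 1 - t ^ 2 = (1 - t) * (1 + t) := by ring
        have h3 : 0 < 1 + t := by linarith [ht.1]
        rw [h2, ← one_div, div_mul_div_comm, div_le_div_iff₀ (by positivity) (by positivity)]
        nlinarith [ht.2]
    rw [hlog] at hle
    linarith [le_abs_self M]

theorem intervalIntegral_relDensity_div_le (n : ℕ) {s : ℝ} (hs0 : 0 < s) (hs1 : s < 1) :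
    ∫ t in (0 : ℝ)..s, relDensity n t / (1 - t ^ 2) ≤ 2 := by
  have hsub : Ioc 0 s ⊆ Ioo (-1 : ℝ) 1 := fun t ht => ⟨by linarith [ht.1], by linarith [ht.2]⟩
  rw [intervalIntegral.integral_of_le hs0.le, integral_eq_lintegral_of_nonneg_ae]
  · refine ENNReal.toReal_le_of_le_ofReal zero_le_two ?_
    rw [ENNReal.ofReal_ofNat]
    exact (lintegral_mono_set hsub).trans (lintegral_transferDensity_le n)
  · filter_upwards [ae_restrict_mem measurableSet_Ioc] with t ht
    exact div_nonneg (relDensity_mem n t).1 (one_sub_sq_pos (hsub ht)).le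
  · exact ((measurable_relDensity n).div (by fun_prop)).aestronglyMeasurable

theorem tendsto_relDensity_at_zero : Tendsto (fun n => relDensity n 0) atTop (𝓝 0) := by
  rw [Metric.tendsto_atTop]
  intro ε hε
  obtain ⟨s, hs0, hs1, hM⟩ := exists_le_intervalIntegral_one_div_one_sub_sq (4 / ε)
  set H := ∫ t in (0 : ℝ)..s, 1 / (1 - t ^ 2) with hH
  have hsub : Ioc 0 s ⊆ Ioo (-1 : ℝ) 1 := fun t ht => ⟨by linarith [ht.1], by linarith [ht.2]⟩
  have hint : IntervalIntegrable (fun t : ℝ => 1 / (1 - t ^ 2)) volume 0 s := by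
    refine ContinuousOn.intervalIntegrable ?_
    rw [uIcc_of_le hs0.le]
    refine continuousOn_const.div (by fun_prop) fun t ht => ?_
    nlinarith [ht.1, ht.2]
  have hintr : ∀ n, IntervalIntegrable (fun t : ℝ => relDensity n t / (1 - t ^ 2))
      volume 0 s := by
    intro n
    refine hint.mono_fun ((measurable_relDensity n).div (by fun_prop)).aestronglyMeasurable ?_
    rw [uIoc_of_le hs0.le]
    filter_upwards [ae_restrict_mem measurableSet_Ioc] with t ht
    have h0 := one_sub_sq_pos (hsub ht)
    have h1 := relDensity_mem n t
    rw [Real.norm_of_nonneg (div_nonneg h1.1 h0.le), Real.norm_of_nonneg (by positivity)]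
    gcongr
    exact h1.2
  have hD : Tendsto (fun n => ∫ t in (0 : ℝ)..s,
      (relDensity (n + 1) t - relDensity n 0) * (1 / (1 - t ^ 2))) atTop
      (𝓝 (∫ t in (0 : ℝ)..s, 0 * (1 / (1 - t ^ 2)))) := by
    refine intervalIntegral.tendsto_integral_filter_of_dominated_convergence
      (fun t => 1 / (1 - t ^ 2)) (Eventually.of_forall fun n => ?_)
      (Eventually.of_forall fun n => ?_) hint ?_
    · exact (((measurable_relDensity (n + 1)).sub measurable_const).mul
        (by fun_prop)).aestronglyMeasurable
    · filter_upwards with t ht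
      rw [uIoc_of_le hs0.le] at ht
      have h0 := one_sub_sq_pos (hsub ht)
      have h1 := relDensity_mem (n + 1) t
      have h2 := relDensity_mem n 0
      rw [norm_mul, Real.norm_of_nonneg (r := 1 / (1 - t ^ 2)) (by positivity)]
      refine mul_le_of_le_one_left (by positivity) ?_
      rw [Real.norm_eq_abs, abs_le]
      constructor <;> linarith [h1.1, h1.2, h2.1, h2.2]
    · have := (ae_restrict_iff' measurableSet_Ioo).1 ae_tendsto_relDensity_sub_zero
      filter_upwards [this] with t ht hts
      rw [uIoc_of_le hs0.le] at hts
      exact (ht (hsub hts)).mul_const _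
  simp only [zero_mul, intervalIntegral.integral_zero] at hD
  obtain ⟨N, hN⟩ := Metric.tendsto_atTop.1 hD 1 one_pos
  refine ⟨N, fun n hn => ?_⟩
  have h1 := hN n hn
  have h2 : ∫ t in (0 : ℝ)..s, (relDensity (n + 1) t - relDensity n 0) * (1 / (1 - t ^ 2)) =
      (∫ t in (0 : ℝ)..s, relDensity (n + 1) t / (1 - t ^ 2)) - relDensity n 0 * H := by
    rw [hH, ← intervalIntegral.integral_const_mul,
      ← intervalIntegral.integral_sub (hintr _) (hint.const_mul _)]
    refine intervalIntegral.integral_congr fun t _ => ?_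
    ring
  have h3 := intervalIntegral_relDensity_div_le (n + 1) hs0 hs1
  rw [h2, Real.dist_eq, sub_zero, abs_lt] at h1
  have h4 := (relDensity_mem n 0).1
  rw [Real.dist_eq, sub_zero, abs_of_nonneg h4]
  have h5 : relDensity n 0 * (4 / ε) ≤ relDensity n 0 * H := mul_le_mul_of_nonneg_left hM h4
  have h6 : relDensity n 0 * (4 / ε) < 4 := by linarith [h1.1]
  rw [mul_div_assoc', div_lt_iff₀ hε] at h6
  linarith

theorem ae_tendsto_relDensity : ∀ᵐ t ∂volume.restrict (Ioo (-1 : ℝ) 1),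
    Tendsto (fun n => relDensity n t) atTop (𝓝 0) := by
  filter_upwards [ae_tendsto_relDensity_sub_zero] with t ht
  rw [← tendsto_add_atTop_iff_nat 1]
  simpa using ht.add tendsto_relDensity_at_zero

theorem tendsto_lintegral_transferDensity {s : ℝ} (hs1 : s < 1) :
    Tendsto (fun n => ∫⁻ t in Icc (-s) s, transferDensity n t) atTop (𝓝 0) := by
  have hsub : Icc (-s) s ⊆ Ioo (-1 : ℝ) 1 := fun t ht => ⟨by linarith [ht.1], by linarith [ht.2]⟩
  rw [← lintegral_zero (μ := volume.restrict (Icc (-s) s))]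
  refine tendsto_lintegral_of_dominated_convergence
    (fun _ => ENNReal.ofReal (1 / (1 - s ^ 2))) measurable_transferDensity (fun n => ?_) ?_ ?_
  · filter_upwards [ae_restrict_mem measurableSet_Icc] with t ht
    refine (transferDensity_le n (hsub ht)).trans (ENNReal.ofReal_le_ofReal ?_)
    have h0 : 0 < 1 - s ^ 2 := by nlinarith [ht.1, ht.2]
    refine one_div_le_one_div_of_le h0 ?_
    nlinarith [ht.1, ht.2]
  · rw [lintegral_const]
    refine ENNReal.mul_ne_top ENNReal.ofReal_ne_top ?_
    simp
  · filter_upwards [ae_restrict_of_ae_restrict_of_subset hsub ae_tendsto_relDensity] with t ht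
    have := ENNReal.tendsto_ofReal (ht.div_const (1 - t ^ 2))
    simpa [transferDensity] using this

/-- `c` vanishes at `0` and has variation on `(-1, 1)` dominated by `C` times the density of the
`n`-th iterate of the transfer operator. -/
structure Dominated (C : NNReal) (n : ℕ) (c : ℝ → ℂ) : Prop where
  measurable : Measurable c
  map_zero : c 0 = 0
  enorm_sub_le : ∀ s ∈ Ioo (-1 : ℝ) 1, ∀ t ∈ Ioo (-1 : ℝ) 1, s ≤ t →
    ‖c t - c s‖ₑ ≤ C * ∫⁻ u in Ioc s t, transferDensity n u

theorem zero_mem_Ioo : (0 : ℝ) ∈ Ioo (-1 : ℝ) 1 := by norm_num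

theorem Dominated.of_lipschitz {C : NNReal} {c : ℝ → ℂ} (hc : Measurable c) (h0 : c 0 = 0)
    (hC : ∀ s ∈ Ioo (-1 : ℝ) 1, ∀ t ∈ Ioo (-1 : ℝ) 1, ‖c t - c s‖ ≤ C * |t - s|) :
    Dominated C 0 c := by
  refine ⟨hc, h0, fun s hs t ht hst => ?_⟩
  have h : ∫⁻ u in Ioc s t, transferDensity 0 u = ENNReal.ofReal (t - s) := by
    rw [setLIntegral_congr_fun (g := fun _ => 1) measurableSet_Ioc]
    · simp
    · intro u hu
      have hu' : u ∈ Ioo (-1 : ℝ) 1 := ⟨hs.1.trans hu.1, hu.2.trans_lt ht.2⟩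
      simp only [transferDensity, relDensity_zero hu', div_self (one_sub_sq_pos hu').ne',
        ENNReal.ofReal_one]
  rw [h, ← ENNReal.ofReal_coe_nnreal, ← ENNReal.ofReal_mul C.coe_nonneg, ← ofReal_norm]
  refine ENNReal.ofReal_le_ofReal ((hC s hs t ht).trans_eq ?_)
  rw [abs_of_nonneg (by linarith)]

/-- The variation bound for `c` on the image of the `k`-th branch. -/
noncomputable def branchBound (C : NNReal) (n : ℕ) (k : NonzeroInt) : ℝ :=
  (C * ∫⁻ u in branch k '' Ioo (-1) 1, transferDensity n u).toReal

theorem tsum_mul_lintegral_branch_image_ne_top (C : NNReal) (n : ℕ) :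
    ∑' k : NonzeroInt, C * ∫⁻ u in branch k '' Ioo (-1) 1, transferDensity n u ≠ ⊤ := by
  rw [ENNReal.tsum_mul_left]
  refine ENNReal.mul_ne_top ENNReal.coe_ne_top (ne_top_of_le_ne_top ENNReal.ofNat_ne_top
    ((tsum_lintegral_branch_image_le _).trans (lintegral_transferDensity_le n)))

theorem summable_branchBound (C : NNReal) (n : ℕ) : Summable (branchBound C n) :=
  ENNReal.summable_toReal (tsum_mul_lintegral_branch_image_ne_top C n)

theorem Ioc_branch_subset {s t : ℝ} (hs : s ∈ Ioo (-1 : ℝ) 1) (ht : t ∈ Ioo (-1 : ℝ) 1)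
    (hst : s ≤ t) (k : NonzeroInt) : Ioc (branch k s) (branch k t) ⊆ branch k '' Ioc s t :=
  intermediate_value_Ioc hst fun _ hu =>
    (hasDerivAt_branch ⟨hs.1.trans_le hu.1, hu.2.trans_lt ht.2⟩ k).continuousAt.continuousWithinAt

namespace Dominated

variable {C : NNReal} {n : ℕ} {c : ℝ → ℂ}

theorem enorm_branch_sub_le (hc : Dominated C n c) {s t : ℝ} (hs : s ∈ Ioo (-1 : ℝ) 1)
    (ht : t ∈ Ioo (-1 : ℝ) 1) (hst : s ≤ t) (k : NonzeroInt) :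
    ‖c (branch k t) - c (branch k s)‖ₑ ≤
      C * ∫⁻ u in branch k '' Ioc s t, transferDensity n u := by
  refine (hc.enorm_sub_le _ (branch_mem hs k) _ (branch_mem ht k)
    (branch_monotoneOn k hs ht hst)).trans ?_
  gcongr
  exact Ioc_branch_subset hs ht hst k

theorem norm_branch_sub_le (hc : Dominated C n c) {s t : ℝ} (hs : s ∈ Ioo (-1 : ℝ) 1)
    (ht : t ∈ Ioo (-1 : ℝ) 1) (k : NonzeroInt) :
    ‖c (branch k t) - c (branch k s)‖ ≤ branchBound C n k := by
  wlog hst : s ≤ t generalizing s t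
  · rw [norm_sub_rev]
    exact this ht hs (le_of_not_ge hst)
  rw [← toReal_enorm]
  refine ENNReal.toReal_mono
    (ENNReal.ne_top_of_tsum_ne_top (tsum_mul_lintegral_branch_image_ne_top C n) k) ?_
  refine (hc.enorm_branch_sub_le hs ht hst k).trans ?_
  gcongr
  exact fun u hu => ⟨hs.1.trans hu.1, hu.2.trans_lt ht.2⟩

theorem summable_branch_sub (hc : Dominated C n c) {s t : ℝ} (hs : s ∈ Ioo (-1 : ℝ) 1)
    (ht : t ∈ Ioo (-1 : ℝ) 1) :
    Summable fun k : NonzeroInt => c (branch k t) - c (branch k s) :=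
  Summable.of_norm_bounded (summable_branchBound C n) fun k => hc.norm_branch_sub_le hs ht k

theorem norm_sub_le (hc : Dominated C n c) {s t : ℝ} (hs : s ∈ Ioo (-1 : ℝ) 1)
    (ht : t ∈ Ioo (-1 : ℝ) 1) : ‖c t - c s‖ ≤ 2 * C := by
  wlog hst : s ≤ t generalizing s t
  · rw [norm_sub_rev]
    exact this ht hs (le_of_not_ge hst)
  rw [← toReal_enorm]
  refine ENNReal.toReal_le_of_le_ofReal (by positivity) ?_
  refine (hc.enorm_sub_le s hs t ht hst).trans ?_
  rw [mul_comm 2, ENNReal.ofReal_mul C.coe_nonneg, ENNReal.ofReal_coe_nnreal, ENNReal.ofReal_ofNat]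
  gcongr
  refine le_trans (lintegral_mono_set ?_) (lintegral_transferDensity_le n)
  exact fun u hu => ⟨hs.1.trans hu.1, hu.2.trans_lt ht.2⟩

theorem norm_le (hc : Dominated C n c) {t : ℝ} (ht : t ∈ Ioo (-1 : ℝ) 1) : ‖c t‖ ≤ 2 * C := by
  have := hc.norm_sub_le zero_mem_Ioo ht
  rwa [hc.map_zero, sub_zero] at this

theorem enorm_le (hc : Dominated C n c) {t : ℝ} (ht : t ∈ Ioo (-1 : ℝ) 1) :
    ‖c t‖ₑ ≤ C * ∫⁻ u in Icc (-|t|) |t|, transferDensity n u := by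
  rcases le_total 0 t with h | h
  · have := hc.enorm_sub_le 0 zero_mem_Ioo t ht h
    rw [hc.map_zero, sub_zero] at this
    refine this.trans ?_
    gcongr
    intro u hu
    rw [abs_of_nonneg h]
    exact ⟨by linarith [hu.1], hu.2⟩
  · have := hc.enorm_sub_le t ht 0 zero_mem_Ioo h
    rw [hc.map_zero, zero_sub, enorm_neg] at this
    refine this.trans ?_
    gcongr
    intro u hu
    rw [abs_of_nonpos h]
    exact ⟨by linarith [hu.1], by linarith [hu.2]⟩

theorem norm_branch_zero_le (hc : Dominated C n c) (k : NonzeroInt) :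
    ‖c (branch k 0)‖ ≤ 2 * C / |((k : ℤ) : ℝ)| := by
  have hk := k.one_le_abs
  set u := branch k 0 with hu
  have hu1 : |u| = 1 / (2 * |((k : ℤ) : ℝ)|) := by
    rw [hu, branch, zero_add, abs_neg, abs_inv, abs_mul, abs_two, one_div]
  have hu2 : |u| ≤ 1 / 2 := by
    rw [hu1]
    refine one_div_le_one_div_of_le two_pos (by linarith)
  rw [← toReal_enorm]
  refine ENNReal.toReal_le_of_le_ofReal (by positivity) ?_
  refine (hc.enorm_le (branch_mem zero_mem_Ioo k)).trans ?_
  have h1 : ∫⁻ v in Icc (-|u|) |u|, transferDensity n v ≤ ENNReal.ofReal (2 / |((k : ℤ) : ℝ)|) := by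
    calc ∫⁻ v in Icc (-|u|) |u|, transferDensity n v
        ≤ ∫⁻ _ in Icc (-|u|) |u|, ENNReal.ofReal 2 := by
          refine setLIntegral_mono measurable_const fun v hv => ?_
          refine (transferDensity_le n ⟨by linarith [hv.1], by linarith [hv.2]⟩).trans
            (ENNReal.ofReal_le_ofReal ?_)
          rw [div_le_iff₀ (by nlinarith [hv.1, hv.2])]
          nlinarith [hv.1, hv.2]
      _ = ENNReal.ofReal (2 / |((k : ℤ) : ℝ)|) := by
          rw [setLIntegral_const, Real.volume_Icc, ← ENNReal.ofReal_mul zero_le_two, hu1]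
          congr 1
          field_simp
          ring
  have h2 : ENNReal.ofReal (2 * C / |((k : ℤ) : ℝ)|) =
      C * ENNReal.ofReal (2 / |((k : ℤ) : ℝ)|) := by
    rw [← ENNReal.ofReal_coe_nnreal, ← ENNReal.ofReal_mul C.coe_nonneg]
    congr 1
    ring
  rw [h2]
  gcongr

end Dominated

/-- The transfer operator on derivatives, integrated: `t ↦ -∑ₖ (c (γₖ t) - c (γₖ 0))`. -/
noncomputable def transferPrimitive (c : ℝ → ℂ) : ℝ → ℂ :=
  (Ioo (-1 : ℝ) 1).indicator fun t => -∑' k : NonzeroInt, (c (branch k t) - c (branch k 0))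

theorem transferPrimitive_of_mem (c : ℝ → ℂ) {t : ℝ} (ht : t ∈ Ioo (-1 : ℝ) 1) :
    transferPrimitive c t = -∑' k : NonzeroInt, (c (branch k t) - c (branch k 0)) :=
  indicator_of_mem ht _

namespace Dominated

variable {C : NNReal} {n : ℕ} {c : ℝ → ℂ}

theorem measurable_transferPrimitive (hc : Dominated C n c) :
    Measurable (transferPrimitive c) := by
  refine measurable_of_tendsto_metrizable' (atTop : Filter (Finset NonzeroInt))
    (f := fun F : Finset NonzeroInt => (Ioo (-1 : ℝ) 1).indicator fun t =>
      -∑ k ∈ F, (c (branch k t) - c (branch k 0))) (fun F => ?_) ?_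
  · refine Measurable.indicator ?_ measurableSet_Ioo
    exact Measurable.fun_neg (Finset.measurable_fun_sum F fun k _ =>
      (hc.measurable.comp (measurable_branch k)).sub_const _)
  · rw [tendsto_pi_nhds]
    intro t
    by_cases ht : t ∈ Ioo (-1 : ℝ) 1
    · simp only [transferPrimitive, indicator_of_mem ht]
      exact Tendsto.neg (hc.summable_branch_sub zero_mem_Ioo ht).hasSum
    · simp only [transferPrimitive, indicator_of_notMem ht]
      exact tendsto_const_nhds

theorem transferPrimitive (hc : Dominated C n c) : Dominated C (n + 1) (transferPrimitive c) := by
  refine ⟨hc.measurable_transferPrimitive, ?_, fun s hs t ht hst => ?_⟩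
  · rw [transferPrimitive_of_mem c zero_mem_Ioo]
    simp
  · have h : _root_.transferPrimitive c t - _root_.transferPrimitive c s =
        -∑' k : NonzeroInt, (c (branch k t) - c (branch k s)) := by
      rw [transferPrimitive_of_mem c ht, transferPrimitive_of_mem c hs, neg_sub_neg,
        ← neg_sub, ← (hc.summable_branch_sub zero_mem_Ioo ht).tsum_sub
          (hc.summable_branch_sub zero_mem_Ioo hs)]
      congr 1
      refine tsum_congr fun k => ?_
      ring
    have hsub : Ioc s t ⊆ Ioo (-1 : ℝ) 1 := fun u hu => ⟨hs.1.trans hu.1, hu.2.trans_lt ht.2⟩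
    rw [h, enorm_neg]
    refine (enorm_tsum_le_tsum_enorm).trans ?_
    refine (ENNReal.tsum_le_tsum fun k => hc.enorm_branch_sub_le hs ht hst k).trans_eq ?_
    rw [ENNReal.tsum_mul_left]
    congr 1
    simp_rw [lintegral_branch_image measurableSet_Ioc hsub]
    rw [← lintegral_tsum]
    · exact setLIntegral_congr_fun measurableSet_Ioc
        fun u hu => (transferDensity_succ n (hsub hu)).symm
    · intro k
      exact ((Measurable.ennreal_ofReal (by fun_prop)).mul
        ((measurable_transferDensity n).comp (measurable_branch k))).aemeasurable

theorem iterate_transferPrimitive (hc : Dominated C 0 c) (j : ℕ) :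
    Dominated C j (_root_.transferPrimitive^[j] c) := by
  induction j with
  | zero => exact hc
  | succ j ih =>
    rw [Function.iterate_succ_apply']
    exact ih.transferPrimitive

theorem tendsto_iterate_transferPrimitive (hc : Dominated C 0 c) {t : ℝ}
    (ht : t ∈ Ioo (-1 : ℝ) 1) :
    Tendsto (fun j => _root_.transferPrimitive^[j] c t) atTop (𝓝 0) := by
  rw [tendsto_zero_iff_enorm_tendsto_zero]
  have h := ENNReal.Tendsto.const_mul
    (tendsto_lintegral_transferDensity (s := |t|) (abs_lt.2 ht))
    (Or.inr (ENNReal.coe_ne_top (r := C)))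
  rw [mul_zero] at h
  exact tendsto_of_tendsto_of_tendsto_of_le_of_le tendsto_const_nhds h (fun _ => zero_le)
    fun j => (hc.iterate_transferPrimitive j).enorm_le ht

end Dominated

/-- The weight-two action of the inversion `t ↦ -1/t`. -/
noncomputable def inversionSlash (φ : ℝ → ℂ) (x : ℝ) : ℂ := ((x ^ 2)⁻¹ : ℝ) * φ (-x⁻¹)

theorem restrict_compl_zero : (volume : Measure ℝ).restrict {0}ᶜ = volume :=
  Measure.restrict_eq_self_of_ae_mem (compl_mem_ae_iff.2 (measure_singleton 0))

theorem image_neg_inv : (fun x : ℝ => -x⁻¹) '' {0}ᶜ = {0}ᶜ := by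
  ext x
  constructor
  · rintro ⟨y, hy, rfl⟩
    simpa using hy
  · intro hx
    exact ⟨-x⁻¹, by simpa using hx, by simp⟩

theorem injective_neg_inv : Function.Injective fun x : ℝ => -x⁻¹ := fun x y h => by
  simpa using h

theorem hasDerivWithinAt_neg_inv {x : ℝ} (hx : x ∈ ({0}ᶜ : Set ℝ)) :
    HasDerivWithinAt (fun x : ℝ => -x⁻¹) (x ^ 2)⁻¹ {0}ᶜ x := by
  have h := (hasDerivAt_inv (by simpa using hx : x ≠ 0)).fun_neg
  rw [neg_neg] at h
  exact h.hasDerivWithinAt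

theorem integrable_inversionSlash {φ : ℝ → ℂ} (hφ : Integrable φ) :
    Integrable (inversionSlash φ) := by
  have h := integrableOn_image_iff_integrableOn_abs_deriv_smul
    (measurableSet_singleton (0 : ℝ)).compl (fun x hx => hasDerivWithinAt_neg_inv hx)
    injective_neg_inv.injOn φ
  rw [image_neg_inv, IntegrableOn, IntegrableOn, restrict_compl_zero] at h
  refine (h.1 hφ).congr (Eventually.of_forall fun x => ?_)
  simp [inversionSlash, abs_of_nonneg (sq_nonneg x)]

theorem integral_inversionSlash_mul (φ v : ℝ → ℂ) :
    ∫ x, inversionSlash φ x * v x = ∫ t, φ t * v (-t⁻¹) := by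
  have h := integral_image_eq_integral_abs_deriv_smul
    (measurableSet_singleton (0 : ℝ)).compl (fun x hx => hasDerivWithinAt_neg_inv hx)
    injective_neg_inv.injOn fun t => φ t * v (-t⁻¹)
  rw [image_neg_inv, restrict_compl_zero] at h
  rw [h]
  refine integral_congr_ae (Eventually.of_forall fun x => ?_)
  simp [inversionSlash, abs_of_nonneg (sq_nonneg x), mul_assoc]

theorem integral_mul_comp_neg_inv_eq_zero {ψ u : ℝ → ℂ} {K : ℝ} (hψ : Integrable ψ)
    (hu : Measurable u) (hK : ∀ t, ‖u t‖ ≤ K) (hper : ∀ t, u (t + 2) = u t)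
    (h1 : ∀ n : ℤ, 0 ≤ n → ∫ t, char2 n (-t⁻¹) * ψ t = 0)
    (h2 : ∀ m : ℤ, 0 < m → ∫ t in (-1 : ℝ)..1, char2 m t * u t = 0) :
    ∫ t, ψ t * u (-t⁻¹) = 0 := by
  rw [← integral_inversionSlash_mul]
  refine integral_mul_eq_zero_of_periodic (integrable_inversionSlash hψ) hu hK hper
    (fun n hn => ?_) h2
  rw [← h1 n hn]
  simp_rw [mul_comm (char2 n _)]
  exact integral_inversionSlash_mul ψ (char2 n)

theorem UpperDecay.integral_char2_mul {Q : ℂ → ℂ} (hQ : UpperDecay Q) {n : ℤ} (hn : 0 ≤ n) :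
    ∫ t : ℝ, char2 n t * Q t = 0 := by
  rw [← hQ.integral_exp_mul_exp_eq_zero (a := Real.pi * n) (b := 0)
    (mul_nonneg Real.pi_pos.le (by exact_mod_cast hn)) le_rfl]
  refine integral_congr_ae (Eventually.of_forall fun t => ?_)
  simp [char2, mul_assoc]

theorem UpperDecay.integral_char2_neg_inv_mul {Q : ℂ → ℂ} (hQ : UpperDecay Q) {n : ℤ}
    (hn : 0 ≤ n) : ∫ t : ℝ, char2 n (-t⁻¹) * Q t = 0 := by
  rw [← hQ.integral_exp_mul_exp_eq_zero (a := 0) (b := Real.pi * n) le_rfl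
    (mul_nonneg Real.pi_pos.le (by exact_mod_cast hn))]
  refine integral_congr_ae (Eventually.of_forall fun t => ?_)
  simp [char2, mul_assoc, div_eq_mul_inv]

theorem norm_exp_I_mul_le_one {a : ℝ} (ha : 0 ≤ a) {z : ℂ} (hz : 0 ≤ z.im) :
    ‖Complex.exp (Complex.I * a * z)‖ ≤ 1 := by
  rw [Complex.norm_exp, Real.exp_le_one_iff]
  simp
  positivity

theorem one_add_sq_le_norm_sq {ε : ℝ} (hε : 0 ≤ ε) {z : ℂ} (hz : 0 ≤ z.im) :
    1 + ε ^ 2 * ‖z‖ ^ 2 ≤ ‖1 - Complex.I * ε * z‖ ^ 2 := by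
  rw [Complex.sq_norm, Complex.sq_norm, Complex.normSq_apply, Complex.normSq_apply]
  simp
  nlinarith [mul_nonneg hε hz]

theorem one_le_norm_one_sub {ε : ℝ} (hε : 0 ≤ ε) {z : ℂ} (hz : 0 ≤ z.im) :
    1 ≤ ‖1 - Complex.I * ε * z‖ := by
  have h := one_add_sq_le_norm_sq hε hz
  have : 0 ≤ ε ^ 2 * ‖z‖ ^ 2 := by positivity
  nlinarith [norm_nonneg (1 - Complex.I * ε * z)]

theorem mul_norm_le_norm_one_sub {ε : ℝ} (hε : 0 ≤ ε) {z : ℂ} (hz : 0 ≤ z.im) :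
    ε * ‖z‖ ≤ ‖1 - Complex.I * ε * z‖ := by
  have h := one_add_sq_le_norm_sq hε hz
  refine abs_le_of_sq_le_sq' ?_ (norm_nonneg _) |>.2
  nlinarith

theorem one_sub_ne_zero {ε : ℝ} (hε : 0 ≤ ε) {z : ℂ} (hz : 0 ≤ z.im) :
    1 - Complex.I * ε * z ≠ 0 := by
  have := one_le_norm_one_sub hε hz
  intro h
  rw [h] at this
  norm_num at this

theorem differentiableAt_inv_one_sub {ε : ℝ} (hε : 0 ≤ ε) {z : ℂ} (hz : 0 ≤ z.im) :
    DifferentiableAt ℂ (fun z : ℂ => (1 - Complex.I * ε * z)⁻¹) z :=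
  DifferentiableAt.inv (by fun_prop) (one_sub_ne_zero hε hz)

theorem norm_inv_one_sub_le {ε : ℝ} (hε : 0 ≤ ε) {z : ℂ} (hz : 0 ≤ z.im) :
    ‖(1 - Complex.I * ε * z)⁻¹‖ ≤ 1 := by
  rw [norm_inv]
  exact inv_le_one_of_one_le₀ (one_le_norm_one_sub hε hz)

/-- A holomorphic regularizer on the upper half-plane. -/
noncomputable def regularizer (ε : ℝ) (z : ℂ) : ℂ := ((1 - Complex.I * ε * z)⁻¹) ^ 2

theorem upperDecay_regularizer {ε : ℝ} (hε : 0 < ε) : UpperDecay (regularizer ε) := by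
  refine ⟨fun z hz => (differentiableAt_inv_one_sub hε.le hz).pow 2, 1 + 1 / ε ^ 2,
    fun z hz => ?_⟩
  have h := one_add_sq_le_norm_sq hε.le hz
  rw [regularizer, norm_pow, norm_inv, inv_pow, ← one_div]
  have h0 : 0 < 1 + ε ^ 2 * ‖z‖ ^ 2 := by positivity
  refine (one_div_le_one_div_of_le h0 h).trans ?_
  rw [div_le_div_iff₀ h0 (by positivity)]
  have : (1 + 1 / ε ^ 2) * (1 + ε ^ 2 * ‖z‖ ^ 2) =
      1 + ‖z‖ ^ 2 + ε ^ 2 * ‖z‖ ^ 2 + 1 / ε ^ 2 := by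
    field_simp
    ring
  rw [this]
  have : 0 ≤ ε ^ 2 * ‖z‖ ^ 2 + 1 / ε ^ 2 := by positivity
  linarith

theorem norm_regularizer_le {ε : ℝ} (hε : 0 ≤ ε) {z : ℂ} (hz : 0 ≤ z.im) :
    ‖regularizer ε z‖ ≤ 1 := by
  rw [regularizer, norm_pow]
  exact pow_le_one₀ (norm_nonneg _) (norm_inv_one_sub_le hε hz)

theorem norm_regularizer_sub_le {ε : ℝ} (hε : 0 ≤ ε) {x y : ℝ} (hy : y ≠ 0)
    (hxy : |x - y| ≤ 1) : ‖regularizer ε x - regularizer ε y‖ ≤ 2 / |y| := by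
  have hx0 : 0 ≤ (x : ℂ).im := by simp
  have hy0 : 0 ≤ (y : ℂ).im := by simp
  have hw : ‖(1 - Complex.I * ε * x)⁻¹ - (1 - Complex.I * ε * y)⁻¹‖ ≤ 1 / |y| := by
    rw [inv_sub_inv (one_sub_ne_zero hε hx0) (one_sub_ne_zero hε hy0)]
    have e : 1 - Complex.I * ε * y - (1 - Complex.I * ε * x) =
        Complex.I * ε * ((x - y : ℝ) : ℂ) := by
      push_cast
      ring
    rw [e, norm_div, norm_mul, norm_mul, norm_mul, Complex.norm_I, one_mul, Complex.norm_real,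
      Complex.norm_real, Real.norm_of_nonneg hε, Real.norm_eq_abs]
    have h1 := one_le_norm_one_sub hε hx0
    have h2 := mul_norm_le_norm_one_sub hε hy0
    have h3 := one_le_norm_one_sub hε hy0
    rw [Complex.norm_real, Real.norm_eq_abs] at h2
    rw [div_le_div_iff₀ (by positivity) (abs_pos.2 hy)]
    calc ε * |x - y| * |y| = |x - y| * (ε * |y|) := by ring
      _ ≤ 1 * (ε * |y|) := by gcongr
      _ = 1 * (ε * |y|) := rfl
      _ ≤ ‖1 - Complex.I * ε * x‖ * ‖1 - Complex.I * ε * y‖ := by gcongr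
      _ = _ := (one_mul _).symm
  have h := norm_inv_one_sub_le hε hx0
  have h' := norm_inv_one_sub_le hε hy0
  rw [regularizer, regularizer, sq_sub_sq, norm_mul]
  calc _ ≤ 2 * (1 / |y|) := by
        refine mul_le_mul ((norm_add_le _ _).trans ?_) hw (norm_nonneg _) zero_le_two
        linarith
    _ = 2 / |y| := by ring

theorem tendsto_regularizer (z : ℂ) : Tendsto (fun ε : ℝ => regularizer ε z) (𝓝 0) (𝓝 1) := by
  have h : ContinuousAt (fun ε : ℝ => regularizer ε z) 0 := by
    unfold regularizer
    refine ContinuousAt.pow (ContinuousAt.inv₀ (by fun_prop) (by simp)) 2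
  simpa [ContinuousAt, regularizer] using h

theorem continuous_regularizer {ε : ℝ} (hε : 0 ≤ ε) :
    Continuous fun t : ℝ => regularizer ε t := by
  unfold regularizer
  exact Continuous.pow (Continuous.inv₀ (by fun_prop)
    fun t => one_sub_ne_zero hε (by simp)) 2

theorem hasSum_setIntegral_translates {F : ℝ → ℂ} (hF : Integrable F) :
    HasSum (fun k : ℤ => ∫ t in Ioo (-1 : ℝ) 1, F (t + 2 * k)) (∫ t, F t) := by
  have h := hasSum_integral_iUnion (μ := volume) (f := F)
    (s := fun n : ℤ => Ioc (-1 + n • (2 : ℝ)) (-1 + (n + 1) • (2 : ℝ)))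
    (fun n => measurableSet_Ioc) (pairwise_disjoint_Ioc_add_zsmul (-1 : ℝ) (2 : ℝ))
    hF.integrableOn
  rw [iUnion_Ioc_add_zsmul two_pos, setIntegral_univ] at h
  convert! h using 1
  funext k
  rw [← integral_Ioc_eq_integral_Ioo, ← intervalIntegral.integral_of_le (by norm_num),
    intervalIntegral.integral_comp_add_right, intervalIntegral.integral_of_le (by linarith)]
  congr 3 <;> simp <;> ring

/-- A bounded test function `f` and its inversion `g`, both annihilating holomorphic functions of
quadratic decay, with `g` Lipschitz near the origin. -/
structure TestPair (C : NNReal) (f g : ℝ → ℂ) : Prop where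
  measurable_fst : Measurable f
  measurable_snd : Measurable g
  norm_fst_le : ∀ t, ‖f t‖ ≤ 1
  norm_snd_le : ∀ t, ‖g t‖ ≤ 1
  fst_neg_inv : ∀ t, t ≠ 0 → f (-t⁻¹) = g t
  dominated : Dominated C 0 g
  integral_fst_mul : ∀ Q, UpperDecay Q → ∫ t : ℝ, f t * Q t = 0
  integral_snd_mul : ∀ Q, UpperDecay Q → ∫ t : ℝ, g t * Q t = 0

/-- The sequence `f, g, f, g, …`. -/
def alternating (f g : ℝ → ℂ) (n : ℕ) : ℝ → ℂ := if Even n then f else g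

/-- The representative of `t` modulo `2` in `[-1, 1)`. -/
noncomputable def redMod (t : ℝ) : ℝ := t - 2 * round (t / 2)

theorem redMod_of_mem {t : ℝ} (ht : t ∈ Ioo (-1 : ℝ) 1) : redMod t = t := by
  have : round (t / 2) = 0 := by
    rw [round_eq_zero_iff]
    constructor <;> linarith [ht.1, ht.2]
  simp [redMod, this]

theorem redMod_add_two (t : ℝ) : redMod (t + 2) = redMod t := by
  have : (t + 2) / 2 = t / 2 + 1 := by ring
  rw [redMod, redMod, this, round_add_one]
  push_cast
  ring

theorem measurable_redMod : Measurable redMod := by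
  have h : Measurable fun t : ℝ => ⌊t / 2 + 1 / 2⌋ := Measurable.floor (by fun_prop)
  unfold redMod
  simp_rw [round_eq]
  exact measurable_id.sub (measurable_const.mul (measurable_from_top.comp h))

/-- The `2`-periodic corrections produced by the coboundary expansion of a test pair. -/
noncomputable def periodicSeq (f g : ℝ → ℂ) : ℕ → ℝ → ℂ
  | 0 => fun _ => 0
  | 1 => fun _ => 0
  | j + 2 => fun t => alternating f g j (redMod t) - transferPrimitive^[j + 1] g (redMod t) -
      periodicSeq f g (j + 1) (-(redMod t)⁻¹)

/-- The `j`-th remainder of the coboundary expansion of a test pair. -/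
noncomputable def remainder (f g : ℝ → ℂ) (j : ℕ) (t : ℝ) : ℂ :=
  alternating f g j t - periodicSeq f g (j + 1) (-t⁻¹) - periodicSeq f g j t

theorem periodicSeq_add_two (f g : ℝ → ℂ) (j : ℕ) (t : ℝ) :
    periodicSeq f g j (t + 2) = periodicSeq f g j t := by
  match j with
  | 0 => rfl
  | 1 => rfl
  | j + 2 => simp only [periodicSeq, redMod_add_two]

theorem remainder_of_mem (f g : ℝ → ℂ) (j : ℕ) {t : ℝ} (ht : t ∈ Ioo (-1 : ℝ) 1) :
    remainder f g j t =
      periodicSeq f g (j + 2) t - periodicSeq f g j t + transferPrimitive^[j + 1] g t := by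
  simp only [remainder, periodicSeq, redMod_of_mem ht]
  ring

theorem neg_inv_mem_Ioo {t : ℝ} (ht : 1 < |t|) : -t⁻¹ ∈ Ioo (-1 : ℝ) 1 := by
  refine abs_lt.1 ?_
  rw [abs_neg, abs_inv]
  exact inv_lt_one_of_one_lt₀ ht

theorem transferPrimitive_eq_zero (c : ℝ → ℂ) {t : ℝ} (ht : t ∉ Ioo (-1 : ℝ) 1) :
    transferPrimitive c t = 0 := indicator_of_notMem ht _

namespace TestPair

variable {C : NNReal} {f g : ℝ → ℂ}

theorem snd_neg_inv (h : TestPair C f g) {t : ℝ} (ht : t ≠ 0) : g (-t⁻¹) = f t := by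
  rw [← h.fst_neg_inv _ (by simpa using ht)]
  simp

theorem alternating_neg_inv (h : TestPair C f g) (n : ℕ) {t : ℝ} (ht : t ≠ 0) :
    alternating f g n (-t⁻¹) = alternating f g (n + 1) t := by
  unfold alternating
  by_cases hn : Even n
  · rw [if_pos hn, if_neg (by simpa [Nat.even_add_one] using hn), h.fst_neg_inv t ht]
  · rw [if_neg hn, if_pos (by simpa [Nat.even_add_one] using hn), h.snd_neg_inv ht]

theorem measurable_alternating (h : TestPair C f g) (n : ℕ) : Measurable (alternating f g n) := by
  unfold alternating
  split_ifs
  exacts [h.measurable_fst, h.measurable_snd]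

theorem norm_alternating_le (h : TestPair C f g) (n : ℕ) (t : ℝ) :
    ‖alternating f g n t‖ ≤ 1 := by
  unfold alternating
  split_ifs
  exacts [h.norm_fst_le t, h.norm_snd_le t]

theorem integral_alternating_mul (h : TestPair C f g) (n : ℕ) {Q : ℂ → ℂ} (hQ : UpperDecay Q) :
    ∫ t : ℝ, alternating f g n t * Q t = 0 := by
  unfold alternating
  split_ifs
  exacts [h.integral_fst_mul Q hQ, h.integral_snd_mul Q hQ]

theorem measurable_periodicSeq (h : TestPair C f g) (j : ℕ) : Measurable (periodicSeq f g j) := by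
  induction j using Nat.twoStepInduction with
  | zero => exact measurable_const
  | one => exact measurable_const
  | more j _ ih =>
    exact (((h.measurable_alternating j).comp measurable_redMod).sub
      ((h.dominated.iterate_transferPrimitive (j + 1)).measurable.comp measurable_redMod)).sub
      (ih.comp measurable_redMod.inv.neg)

theorem norm_transferPrimitive_le (h : TestPair C f g) (j : ℕ) (t : ℝ) :
    ‖transferPrimitive^[j + 1] g t‖ ≤ 2 * C := by
  by_cases ht : t ∈ Ioo (-1 : ℝ) 1
  · exact (h.dominated.iterate_transferPrimitive (j + 1)).norm_le ht
  · rw [Function.iterate_succ_apply', transferPrimitive_eq_zero _ ht, norm_zero]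
    positivity

theorem norm_periodicSeq_le (h : TestPair C f g) (j : ℕ) (t : ℝ) :
    ‖periodicSeq f g j t‖ ≤ j * (1 + 2 * C) := by
  induction j using Nat.twoStepInduction generalizing t with
  | zero => simp [periodicSeq]
  | one =>
    simp only [periodicSeq, norm_zero]
    positivity
  | more j _ ih =>
    refine (norm_sub_le _ _).trans (le_trans (add_le_add (norm_sub_le _ _) (ih _)) ?_)
    have h1 := h.norm_alternating_le j (redMod t)
    have h2 := h.norm_transferPrimitive_le j (redMod t)
    push_cast
    nlinarith [C.coe_nonneg]

theorem remainder_of_one_lt_abs (h : TestPair C f g) (j : ℕ) {t : ℝ} (ht : 1 < |t|) :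
    remainder f g j t = transferPrimitive^[j] g (-t⁻¹) := by
  have h0 : t ≠ 0 := by
    rintro rfl
    norm_num at ht
  match j with
  | 0 =>
    simp only [remainder, periodicSeq, sub_zero, Function.iterate_zero, id_eq, h.snd_neg_inv h0]
    simp [alternating]
  | j + 1 =>
    have h1 := redMod_of_mem (neg_inv_mem_Ioo ht)
    simp only [remainder, periodicSeq, h1, h.alternating_neg_inv j h0, inv_neg, neg_neg, inv_inv]
    ring

theorem measurable_remainder (h : TestPair C f g) (j : ℕ) : Measurable (remainder f g j) :=
  ((h.measurable_alternating j).sub ((h.measurable_periodicSeq (j + 1)).comp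
    measurable_inv.neg)).sub (h.measurable_periodicSeq j)

theorem norm_remainder_le (h : TestPair C f g) (j : ℕ) (t : ℝ) :
    ‖remainder f g j t‖ ≤ 1 + (j + 1) * (1 + 2 * C) + j * (1 + 2 * C) := by
  refine (norm_sub_le _ _).trans (add_le_add ((norm_sub_le _ _).trans (add_le_add
    (h.norm_alternating_le j t) ?_)) (h.norm_periodicSeq_le j t))
  exact_mod_cast h.norm_periodicSeq_le (j + 1) (-t⁻¹)

theorem integrable_mul_remainder (h : TestPair C f g) (j : ℕ) {ψ : ℝ → ℂ} (hψ : Integrable ψ) :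
    Integrable fun t => ψ t * remainder f g j t :=
  hψ.mul_bdd (h.measurable_remainder j).aestronglyMeasurable
    (Eventually.of_forall (h.norm_remainder_le j))

/-- If `ψ` is orthogonal to both families of exponentials, pairing with `ψ` does not see the
periodic corrections. -/
theorem integral_mul_remainder (h : TestPair C f g) (j : ℕ) {ψ : ℝ → ℂ} (hψ : Integrable ψ)
    (h1 : ∀ n : ℤ, 0 ≤ n → ∫ t, char2 n t * ψ t = 0)
    (h2 : ∀ n : ℤ, 0 ≤ n → ∫ t, char2 n (-t⁻¹) * ψ t = 0)
    (hP : ∀ i ≤ j + 1, ∀ m : ℤ, 0 < m →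
      ∫ t in (-1 : ℝ)..1, char2 m t * periodicSeq f g i t = 0) :
    ∫ t, ψ t * remainder f g j t = ∫ t, ψ t * alternating f g j t := by
  have e1 := integral_mul_comp_neg_inv_eq_zero hψ (h.measurable_periodicSeq (j + 1))
    (h.norm_periodicSeq_le (j + 1)) (periodicSeq_add_two f g _) h2 (hP (j + 1) le_rfl)
  have e2 := integral_mul_eq_zero_of_periodic hψ (h.measurable_periodicSeq j)
    (h.norm_periodicSeq_le j) (periodicSeq_add_two f g _) h1 (hP j (by omega))
  have i0 : Integrable fun t => ψ t * alternating f g j t :=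
    hψ.mul_bdd (h.measurable_alternating j).aestronglyMeasurable
      (Eventually.of_forall (h.norm_alternating_le j))
  have i1 : Integrable fun t => ψ t * periodicSeq f g (j + 1) (-t⁻¹) :=
    hψ.mul_bdd ((h.measurable_periodicSeq (j + 1)).comp measurable_inv.neg).aestronglyMeasurable
      (Eventually.of_forall fun t => h.norm_periodicSeq_le (j + 1) (-t⁻¹))
  have i2 : Integrable fun t => ψ t * periodicSeq f g j t :=
    hψ.mul_bdd (h.measurable_periodicSeq j).aestronglyMeasurable
      (Eventually.of_forall (h.norm_periodicSeq_le j))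
  simp only [remainder, mul_sub]
  rw [integral_sub (f := fun t => ψ t * alternating f g j t -
    ψ t * periodicSeq f g (j + 1) (-t⁻¹)) (i0.sub i1) i2, integral_sub i0 i1, e1, e2,
    sub_zero, sub_zero]

theorem integral_mul_remainder_eq_zero (h : TestPair C f g) (j : ℕ) {Q : ℂ → ℂ}
    (hQ : UpperDecay Q) (hP : ∀ i ≤ j + 1, ∀ m : ℤ, 0 < m →
      ∫ t in (-1 : ℝ)..1, char2 m t * periodicSeq f g i t = 0) :
    ∫ t : ℝ, Q t * remainder f g j t = 0 := by
  rw [h.integral_mul_remainder j hQ.integrable (fun n => hQ.integral_char2_mul)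
    (fun n => hQ.integral_char2_neg_inv_mul) hP, ← h.integral_alternating_mul j hQ]
  simp_rw [mul_comm]

end TestPair

theorem UpperDecay.char2_mul {Q : ℂ → ℂ} (hQ : UpperDecay Q) {m : ℤ} (hm : 0 ≤ m) :
    UpperDecay fun z => Complex.exp (Complex.I * (Real.pi * m : ℝ) * z) * Q z :=
  hQ.mul (fun z _ => by fun_prop) fun z hz =>
    norm_exp_I_mul_le_one (mul_nonneg Real.pi_pos.le (by exact_mod_cast hm)) hz

theorem integrableOn_Ioo_of_bound {u : ℝ → ℂ} {K : ℝ} (hu : Measurable u)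
    (hK : ∀ t ∈ Ioo (-1 : ℝ) 1, ‖u t‖ ≤ K) : IntegrableOn u (Ioo (-1 : ℝ) 1) :=
  Measure.integrableOn_of_bounded (by simp) hu.aestronglyMeasurable
    (by filter_upwards [ae_restrict_mem measurableSet_Ioo] with t ht using hK t ht)

theorem intervalIntegral_eq_setIntegral_Ioo (u : ℝ → ℂ) :
    ∫ t in (-1 : ℝ)..1, u t = ∫ t in Ioo (-1 : ℝ) 1, u t := by
  rw [intervalIntegral.integral_of_le (by norm_num), integral_Ioc_eq_integral_Ioo]

theorem norm_setIntegral_Ioo_le {u : ℝ → ℂ} {K : ℝ} (hK : ∀ t ∈ Ioo (-1 : ℝ) 1, ‖u t‖ ≤ K) :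
    ‖∫ t in Ioo (-1 : ℝ) 1, u t‖ ≤ K * 2 := by
  have := norm_setIntegral_le_of_norm_le_const (μ := volume) (s := Ioo (-1 : ℝ) 1) (by simp) hK
  simpa [Measure.real, one_add_one_eq_two] using this

theorem summable_one_div_sq_nonzeroInt :
    Summable fun k : NonzeroInt => 1 / |((k : ℤ) : ℝ)| * (1 / |((k : ℤ) : ℝ)|) := by
  have h := (Real.summable_one_div_int_pow (p := 2)).2 one_lt_two
  refine (h.comp_injective Subtype.val_injective).congr fun k => ?_
  simp only [Function.comp]
  rw [div_mul_div_comm, one_mul, abs_mul_abs_self, sq]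

namespace Dominated

variable {C : NNReal} {n : ℕ} {c : ℝ → ℂ}

/-- The regularized and recentred contribution of the `k`-th branch. -/
noncomputable def _root_.branchTerm (c : ℝ → ℂ) (ε : ℝ) (k : NonzeroInt) (t : ℝ) : ℂ :=
  c (branch k t) * regularizer ε ((t + 2 * (k : ℤ) : ℝ) : ℂ) -
    c (branch k 0) * regularizer ε ((2 * (k : ℤ) : ℝ) : ℂ)

theorem norm_branchTerm_le (hc : Dominated C n c) {ε : ℝ} (hε : 0 ≤ ε) (k : NonzeroInt) {t : ℝ}
    (ht : t ∈ Ioo (-1 : ℝ) 1) : ‖branchTerm c ε k t‖ ≤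
      branchBound C n k + 2 * C * (1 / |((k : ℤ) : ℝ)| * (1 / |((k : ℤ) : ℝ)|)) := by
  have hk : (0 : ℝ) < |((k : ℤ) : ℝ)| := by linarith [k.one_le_abs]
  have e : branchTerm c ε k t =
      (c (branch k t) - c (branch k 0)) * regularizer ε ((t + 2 * (k : ℤ) : ℝ) : ℂ) +
      c (branch k 0) * (regularizer ε ((t + 2 * (k : ℤ) : ℝ) : ℂ) -
        regularizer ε ((2 * (k : ℤ) : ℝ) : ℂ)) := by
    unfold branchTerm
    ring
  have h1 := hc.norm_branch_sub_le zero_mem_Ioo ht k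
  have h2 := hc.norm_branch_zero_le k
  have h3 : ‖regularizer ε ((t + 2 * (k : ℤ) : ℝ) : ℂ)‖ ≤ 1 :=
    norm_regularizer_le hε (Complex.ofReal_im _).ge
  have h4 : ‖regularizer ε ((t + 2 * (k : ℤ) : ℝ) : ℂ) - regularizer ε ((2 * (k : ℤ) : ℝ) : ℂ)‖ ≤
      2 / |2 * ((k : ℤ) : ℝ)| := by
    refine norm_regularizer_sub_le hε (mul_ne_zero two_ne_zero (abs_pos.1 hk)) ?_
    rw [add_sub_cancel_right]
    exact (abs_lt.2 ht).le
  have h5 : 2 / |2 * ((k : ℤ) : ℝ)| = 1 / |((k : ℤ) : ℝ)| := by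
    rw [abs_mul, abs_two]
    field_simp
  rw [h5] at h4
  rw [e]
  refine (norm_add_le _ _).trans (add_le_add ?_ ?_)
  · rw [norm_mul]
    exact (mul_le_of_le_one_right (norm_nonneg _) h3).trans h1
  · rw [norm_mul]
    calc _ ≤ 2 * C / |((k : ℤ) : ℝ)| * (1 / |((k : ℤ) : ℝ)|) := by gcongr
      _ = _ := by ring

theorem measurable_branchTerm (hc : Dominated C n c) {ε : ℝ} (hε : 0 ≤ ε) (k : NonzeroInt) :
    Measurable (branchTerm c ε k) :=
  ((hc.measurable.comp (measurable_branch k)).mul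
    ((continuous_regularizer hε).measurable.comp (measurable_id.add_const _))).sub_const _

theorem tendsto_branchTerm (c : ℝ → ℂ) (k : NonzeroInt) (t : ℝ) :
    Tendsto (fun ε => branchTerm c ε k t) (𝓝[>] 0) (𝓝 (c (branch k t) - c (branch k 0))) := by
  have h := ((tendsto_regularizer ((t + 2 * (k : ℤ) : ℝ) : ℂ)).const_mul (c (branch k t))).sub
    ((tendsto_regularizer ((2 * (k : ℤ) : ℝ) : ℂ)).const_mul (c (branch k 0)))
  rw [mul_one, mul_one] at h
  exact h.mono_left nhdsWithin_le_nhds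

theorem tendsto_tsum_integral_branchTerm (hc : Dominated C n c) (m : ℤ) :
    Tendsto (fun ε => ∑' k : NonzeroInt, ∫ t in Ioo (-1 : ℝ) 1, char2 m t * branchTerm c ε k t)
      (𝓝[>] 0) (𝓝 (∑' k : NonzeroInt, ∫ t in Ioo (-1 : ℝ) 1,
        char2 m t * (c (branch k t) - c (branch k 0)))) := by
  refine tendsto_tsum_of_dominated_convergence (bound := fun k => (branchBound C n k +
    2 * C * (1 / |((k : ℤ) : ℝ)| * (1 / |((k : ℤ) : ℝ)|))) * 2) ?_ (fun k => ?_) ?_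
  · exact ((summable_branchBound C n).add
      (summable_one_div_sq_nonzeroInt.mul_left _)).mul_right _
  · refine tendsto_integral_filter_of_dominated_convergence (fun _ => branchBound C n k +
      2 * C * (1 / |((k : ℤ) : ℝ)| * (1 / |((k : ℤ) : ℝ)|))) ?_ ?_ ?_ ?_
    · filter_upwards [self_mem_nhdsWithin] with ε hε
      exact ((continuous_char2 m).measurable.mul
        (hc.measurable_branchTerm (le_of_lt hε) k)).aestronglyMeasurable
    · filter_upwards [self_mem_nhdsWithin] with ε hε
      filter_upwards [ae_restrict_mem measurableSet_Ioo] with t ht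
      rw [norm_mul, norm_char2, one_mul]
      exact hc.norm_branchTerm_le (le_of_lt hε) k ht
    · exact integrable_const _
    · exact Eventually.of_forall fun t => (tendsto_branchTerm c k t).const_mul _
  · filter_upwards [self_mem_nhdsWithin] with ε hε k
    refine norm_setIntegral_Ioo_le fun t ht => ?_
    rw [norm_mul, norm_char2, one_mul]
    exact hc.norm_branchTerm_le (le_of_lt hε) k ht

theorem tsum_integral_branch_sub (hc : Dominated C n c) (m : ℤ) :
    ∑' k : NonzeroInt, ∫ t in Ioo (-1 : ℝ) 1, char2 m t * (c (branch k t) - c (branch k 0)) =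
      -∫ t in Ioo (-1 : ℝ) 1, char2 m t * _root_.transferPrimitive c t := by
  have hb : ∀ (k : NonzeroInt), ∀ t ∈ Ioo (-1 : ℝ) 1,
      ‖char2 m t * (c (branch k t) - c (branch k 0))‖ ≤ branchBound C n k := by
    intro k t ht
    rw [norm_mul, norm_char2, one_mul]
    exact hc.norm_branch_sub_le zero_mem_Ioo ht k
  have h := hasSum_integral_of_summable_integral_norm
    (μ := volume.restrict (Ioo (-1 : ℝ) 1))
    (F := fun (k : NonzeroInt) t => char2 m t * (c (branch k t) - c (branch k 0)))
    (fun k => integrableOn_Ioo_of_bound ((continuous_char2 m).measurable.mul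
      ((hc.measurable.comp (measurable_branch k)).sub_const _)) (hb k)) ?_
  · rw [h.tsum_eq, ← integral_neg]
    refine setIntegral_congr_fun measurableSet_Ioo fun t ht => ?_
    rw [tsum_mul_left, transferPrimitive_of_mem c ht, mul_neg, neg_neg]
  · refine Summable.of_nonneg_of_le (fun k => integral_nonneg fun t => norm_nonneg _)
      (fun k => ?_) ((summable_branchBound C n).mul_right 2)
    have h1 := norm_setIntegral_le_of_norm_le_const (μ := volume) (s := Ioo (-1 : ℝ) 1) (by simp)
      (f := fun t => ‖char2 m t * (c (branch k t) - c (branch k 0))‖)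
      (fun t ht => (norm_norm _).trans_le (hb k t ht))
    refine (Real.le_norm_self _).trans (h1.trans_eq ?_)
    norm_num [Measure.real]

end Dominated

namespace TestPair

variable {C : NNReal} {f g : ℝ → ℂ}

theorem integral_char2_regularizer_remainder (h : TestPair C f g) (j : ℕ)
    (hP : ∀ i ≤ j + 1, ∀ m : ℤ, 0 < m →
      ∫ t in (-1 : ℝ)..1, char2 m t * periodicSeq f g i t = 0) {m : ℤ} (hm : 0 < m) {ε : ℝ}
    (hε : 0 < ε) :
    (∫ t in Ioo (-1 : ℝ) 1, char2 m t * regularizer ε t * remainder f g j t) +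
      ∑' k : NonzeroInt, ∫ t in Ioo (-1 : ℝ) 1,
        char2 m t * branchTerm (transferPrimitive^[j] g) ε k t = 0 := by
  have hQ := (upperDecay_regularizer hε).char2_mul hm.le
  have hQe : ∀ t : ℝ, Complex.exp (Complex.I * (Real.pi * m : ℝ) * t) * regularizer ε t =
      char2 m t * regularizer ε t := by
    intro t
    simp [char2, mul_assoc]
  have hint := h.integrable_mul_remainder j hQ.integrable
  have hzero := h.integral_mul_remainder_eq_zero j hQ hP
  simp_rw [hQe] at hint hzero
  have hs := hasSum_setIntegral_translates hint
  rw [hzero] at hs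
  have hsplit := hs.summable.tsum_subtype_add_tsum_subtype_compl ({0} : Set ℤ)
  rw [hs.tsum_eq, tsum_singleton (0 : ℤ)
    (fun k : ℤ => ∫ t in Ioo (-1 : ℝ) 1, char2 m (t + 2 * k) *
      regularizer ε ((t + 2 * k : ℝ) : ℂ) * remainder f g j (t + 2 * k))] at hsplit
  rw [← hsplit]
  have hc := h.dominated.iterate_transferPrimitive j
  congr 1
  · simp
  · refine tsum_congr (β := NonzeroInt) fun k => ?_
    have e0 : ∫ t in Ioo (-1 : ℝ) 1, char2 m t * (transferPrimitive^[j] g (branch k 0) *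
        regularizer ε ((2 * (k : ℤ) : ℝ) : ℂ)) = 0 := by
      rw [integral_mul_const, ← intervalIntegral_eq_setIntegral_Ioo,
        intervalIntegral_char2 hm.ne', zero_mul]
    have i1 : IntegrableOn (fun t => char2 m t * (transferPrimitive^[j] g (branch k t) *
        regularizer ε ((t + 2 * (k : ℤ) : ℝ) : ℂ))) (Ioo (-1) 1) := by
      refine integrableOn_Ioo_of_bound (K := 2 * C * 1) ((continuous_char2 m).measurable.mul
        ((hc.measurable.comp (measurable_branch k)).mul ((continuous_regularizer
          hε.le).measurable.comp (measurable_id.add_const _)))) fun t ht => ?_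
      rw [norm_mul, norm_char2, one_mul, norm_mul]
      refine mul_le_mul (hc.norm_le (branch_mem ht k))
        (norm_regularizer_le hε.le (Complex.ofReal_im _).ge) (norm_nonneg _) (by positivity)
    have i2 : IntegrableOn (fun t => char2 m t * (transferPrimitive^[j] g (branch k 0) *
        regularizer ε ((2 * (k : ℤ) : ℝ) : ℂ))) (Ioo (-1) 1) :=
      integrableOn_Ioo_of_bound ((continuous_char2 m).measurable.mul_const _)
        fun t _ => by rw [norm_mul, norm_char2, one_mul]
    simp only [branchTerm, mul_sub]
    rw [integral_sub i1 i2, e0, sub_zero]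
    refine setIntegral_congr_fun measurableSet_Ioo fun t ht => ?_
    rw [h.remainder_of_one_lt_abs j (one_lt_abs_add ht k), char2_add, char2_two_mul_int, branch]
    ring

theorem tendsto_integral_regularizer_remainder (h : TestPair C f g) (j : ℕ) (m : ℤ) :
    Tendsto (fun ε : ℝ => ∫ t in Ioo (-1 : ℝ) 1, char2 m t * regularizer ε t * remainder f g j t)
      (𝓝[>] 0) (𝓝 (∫ t in Ioo (-1 : ℝ) 1, char2 m t * remainder f g j t)) := by
  refine tendsto_integral_filter_of_dominated_convergence
    (fun _ => 1 + (j + 1) * (1 + 2 * C) + j * (1 + 2 * C)) ?_ ?_ (integrable_const _) ?_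
  · filter_upwards [self_mem_nhdsWithin] with ε hε
    exact (((continuous_char2 m).mul (continuous_regularizer (le_of_lt hε))).measurable.mul
      (h.measurable_remainder j)).aestronglyMeasurable
  · filter_upwards [self_mem_nhdsWithin] with ε hε
    refine Eventually.of_forall fun t => ?_
    rw [norm_mul, norm_mul, norm_char2, one_mul]
    exact (mul_le_of_le_one_left (norm_nonneg _) (norm_regularizer_le (le_of_lt hε)
      (Complex.ofReal_im _).ge)).trans (h.norm_remainder_le j t)
  · refine Eventually.of_forall fun t => ?_
    have := ((tendsto_regularizer (t : ℂ)).const_mul (char2 m t)).mul_const (remainder f g j t)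
    rw [mul_one] at this
    exact this.mono_left nhdsWithin_le_nhds

theorem integral_char2_remainder_sub (h : TestPair C f g) (j : ℕ)
    (hP : ∀ i ≤ j + 1, ∀ m : ℤ, 0 < m →
      ∫ t in (-1 : ℝ)..1, char2 m t * periodicSeq f g i t = 0) {m : ℤ} (hm : 0 < m) :
    (∫ t in Ioo (-1 : ℝ) 1, char2 m t * remainder f g j t) -
      ∫ t in Ioo (-1 : ℝ) 1, char2 m t * transferPrimitive^[j + 1] g t = 0 := by
  have hc := h.dominated.iterate_transferPrimitive j
  rw [Function.iterate_succ_apply', sub_eq_add_neg, ← hc.tsum_integral_branch_sub m]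
  refine tendsto_nhds_unique ((h.tendsto_integral_regularizer_remainder j m).add
    (hc.tendsto_tsum_integral_branchTerm m)) (tendsto_const_nhds.congr' ?_)
  filter_upwards [self_mem_nhdsWithin] with ε hε
  exact (h.integral_char2_regularizer_remainder j hP hm hε).symm

theorem integral_char2_mul_periodicSeq (h : TestPair C f g) (j : ℕ) {m : ℤ} (hm : 0 < m) :
    ∫ t in (-1 : ℝ)..1, char2 m t * periodicSeq f g j t = 0 := by
  induction j using Nat.strong_induction_on generalizing m with
  | _ j ih =>
  match j with
  | 0 => simp [periodicSeq]
  | 1 => simp [periodicSeq]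
  | j + 2 =>
    have hP : ∀ i ≤ j + 1, ∀ m : ℤ, 0 < m →
      ∫ t in (-1 : ℝ)..1, char2 m t * periodicSeq f g i t = 0 := fun i hi m hm =>
        ih i (by omega) hm
    have h0 := h.integral_char2_remainder_sub j hP hm
    have hi : ∀ i, IntegrableOn (fun t => char2 m t * periodicSeq f g i t) (Ioo (-1) 1) :=
      fun i => integrableOn_Ioo_of_bound ((continuous_char2 m).measurable.mul
        (h.measurable_periodicSeq i)) fun t _ => by
          rw [norm_mul, norm_char2, one_mul]
          exact h.norm_periodicSeq_le i t
    have hi' : IntegrableOn (fun t => char2 m t * transferPrimitive^[j + 1] g t) (Ioo (-1) 1) :=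
      integrableOn_Ioo_of_bound ((continuous_char2 m).measurable.mul
        (h.dominated.iterate_transferPrimitive (j + 1)).measurable) fun t _ => by
          rw [norm_mul, norm_char2, one_mul]
          exact h.norm_transferPrimitive_le j t
    have h1 : ∫ t in Ioo (-1 : ℝ) 1, char2 m t * remainder f g j t =
        (∫ t in Ioo (-1 : ℝ) 1, char2 m t * periodicSeq f g (j + 2) t) -
        (∫ t in Ioo (-1 : ℝ) 1, char2 m t * periodicSeq f g j t) +
        ∫ t in Ioo (-1 : ℝ) 1, char2 m t * transferPrimitive^[j + 1] g t := by
      rw [← integral_sub (hi _) (hi _), ← integral_add (f := fun t =>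
        char2 m t * periodicSeq f g (j + 2) t - char2 m t * periodicSeq f g j t)
        ((hi _).sub (hi _)) hi']
      refine setIntegral_congr_fun measurableSet_Ioo fun t ht => ?_
      simp only [remainder_of_mem f g j ht]
      ring
    have h2 := hP j (by omega) m hm
    rw [intervalIntegral_eq_setIntegral_Ioo] at h2 ⊢
    rw [h1, h2] at h0
    linear_combination h0

end TestPair

theorem tendsto_integral_mul_of_approx {μ : Measure ℝ} {R : ℕ → ℝ → ℂ} {M : ℝ}
    (hR : ∀ N, Measurable (R N)) (hM : ∀ N, ∀ᵐ t ∂μ, ‖R N t‖ ≤ M) {ψ : ℝ → ℂ}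
    (hψ : Integrable ψ μ)
    (happ : ∀ δ > 0, ∃ χ : ℝ → ℂ, Integrable χ μ ∧ ∫ t, ‖ψ t - χ t‖ ∂μ ≤ δ ∧
      Tendsto (fun N => ∫ t, χ t * R N t ∂μ) atTop (𝓝 0)) :
    Tendsto (fun N => ∫ t, ψ t * R N t ∂μ) atTop (𝓝 0) := by
  rw [Metric.tendsto_atTop]
  intro η hη
  have hK : 0 < max M 1 := lt_max_of_lt_right one_pos
  obtain ⟨χ, hχ, hd, hlim⟩ := happ (η / 2 / max M 1) (by positivity)
  obtain ⟨N₀, hN₀⟩ := Metric.tendsto_atTop.1 hlim (η / 2) (half_pos hη)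
  refine ⟨N₀, fun N hN => ?_⟩
  have hmul : ∀ {ρ : ℝ → ℂ}, Integrable ρ μ → Integrable (fun t => ρ t * R N t) μ := fun hρ =>
    hρ.mul_bdd (hR N).aestronglyMeasurable (hM N)
  have e : ∫ t, ψ t * R N t ∂μ = ∫ t, (ψ t - χ t) * R N t ∂μ + ∫ t, χ t * R N t ∂μ := by
    rw [← integral_add (hmul (ρ := fun t => ψ t - χ t) (hψ.sub hχ)) (hmul hχ)]
    congr 1 with t
    ring
  have h1 : ‖∫ t, (ψ t - χ t) * R N t ∂μ‖ ≤ η / 2 := by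
    calc ‖∫ t, (ψ t - χ t) * R N t ∂μ‖ ≤ ∫ t, ‖ψ t - χ t‖ * max M 1 ∂μ := by
          refine norm_integral_le_of_norm_le ((hψ.sub hχ).norm.mul_const _) ?_
          filter_upwards [hM N] with t ht
          rw [norm_mul]
          exact mul_le_mul_of_nonneg_left (ht.trans (le_max_left _ _)) (norm_nonneg _)
      _ = (∫ t, ‖ψ t - χ t‖ ∂μ) * max M 1 := integral_mul_const _ _
      _ ≤ η / 2 / max M 1 * max M 1 := by gcongr
      _ = η / 2 := div_mul_cancel₀ _ hK.ne'
  have h2 := hN₀ N hN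
  rw [dist_zero_right] at h2 ⊢
  rw [e]
  linarith [norm_add_le (∫ t, (ψ t - χ t) * R N t ∂μ) (∫ t, χ t * R N t ∂μ)]

/-- The bounded holomorphic approximation of the monomial `t ^ p`. -/
noncomputable def regularizedPow (p : ℕ) (ε : ℝ) (z : ℂ) : ℂ :=
  (z * (1 - Complex.I * ε * z)⁻¹) ^ p * regularizer ε z

theorem upperDecay_regularizedPow (p : ℕ) {ε : ℝ} (hε : 0 < ε) :
    UpperDecay (regularizedPow p ε) := by
  refine (upperDecay_regularizer hε).mul (B := fun z => (z * (1 - Complex.I * ε * z)⁻¹) ^ p)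
    (K := (ε⁻¹) ^ p) (fun z hz => ?_) fun z hz => ?_
  · exact (differentiableAt_id.mul (differentiableAt_inv_one_sub hε.le hz)).pow p
  · rw [norm_pow]
    refine pow_le_pow_left₀ (norm_nonneg _) ?_ p
    rw [norm_mul, norm_inv, ← div_eq_mul_inv,
      div_le_iff₀ (norm_pos_iff.2 (one_sub_ne_zero hε.le hz)),
      inv_mul_eq_div, le_div_iff₀ hε, mul_comm]
    exact mul_norm_le_norm_one_sub hε.le hz

theorem norm_regularizedPow_le (p : ℕ) {ε : ℝ} (hε : 0 ≤ ε) {t : ℝ} (ht : |t| ≤ 1) :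
    ‖regularizedPow p ε t‖ ≤ 1 := by
  have hz : 0 ≤ (t : ℂ).im := (Complex.ofReal_im t).ge
  rw [regularizedPow, norm_mul, norm_pow, norm_mul]
  refine mul_le_one₀ (pow_le_one₀ (by positivity) (mul_le_one₀ ?_ (norm_nonneg _)
    (norm_inv_one_sub_le hε hz))) (norm_nonneg _) (norm_regularizer_le hε hz)
  simpa using ht

theorem tendsto_regularizedPow (p : ℕ) (z : ℂ) :
    Tendsto (fun ε : ℝ => regularizedPow p ε z) (𝓝 0) (𝓝 (z ^ p)) := by
  have h : Tendsto (fun ε : ℝ => (1 - Complex.I * ε * z)⁻¹) (𝓝 0) (𝓝 1) := by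
    have : ContinuousAt (fun ε : ℝ => (1 - Complex.I * ε * z)⁻¹) 0 := by
      refine ContinuousAt.inv₀ (by fun_prop) (by simp)
    simpa [ContinuousAt] using this
  simpa [regularizedPow] using ((h.const_mul z).pow p).mul (tendsto_regularizer z)

theorem tendsto_integral_norm_pow_sub_regularizedPow (p : ℕ) :
    Tendsto (fun ε => ∫ t : ℝ in Ioo (-1 : ℝ) 1, ‖(t : ℂ) ^ p - regularizedPow p ε t‖)
      (𝓝[>] 0) (𝓝 0) := by
  suffices Tendsto (fun ε => ∫ t : ℝ in Ioo (-1 : ℝ) 1, ‖(t : ℂ) ^ p - regularizedPow p ε t‖)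
      (𝓝[>] 0) (𝓝 (∫ _ in Ioo (-1 : ℝ) 1, (0 : ℝ))) by rwa [integral_zero] at this
  refine tendsto_integral_filter_of_dominated_convergence (fun _ => 2) ?_ ?_
    (integrable_const _) ?_
  · filter_upwards [self_mem_nhdsWithin] with ε hε
    exact ((Complex.continuous_ofReal.pow p).aestronglyMeasurable.sub
      (upperDecay_regularizedPow p hε).integrable.aestronglyMeasurable.restrict).norm
  · filter_upwards [self_mem_nhdsWithin] with ε hε
    filter_upwards [ae_restrict_mem measurableSet_Ioo] with t ht
    have ht' : |t| ≤ 1 := (abs_lt.2 ht).le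
    rw [norm_norm]
    refine (norm_sub_le _ _).trans ?_
    have h1 : ‖(t : ℂ) ^ p‖ ≤ 1 := by
      rw [norm_pow]
      exact pow_le_one₀ (norm_nonneg _) (by simpa using ht')
    linarith [norm_regularizedPow_le p (le_of_lt hε) ht']
  · refine Eventually.of_forall fun t => ?_
    have := ((tendsto_regularizedPow p t).const_sub ((t : ℂ) ^ p)).norm
    rw [sub_self, norm_zero] at this
    exact this.mono_left nhdsWithin_le_nhds

/-- A bounded sequence annihilated by all holomorphic functions of quadratic decay, and tending to
zero off `(-1, 1)`. -/
structure WeaklyNegligible (R : ℕ → ℝ → ℂ) (M : ℝ) : Prop where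
  measurable : ∀ N, Measurable (R N)
  norm_le : ∀ N, ∀ᵐ t, ‖R N t‖ ≤ M
  tendsto_zero : ∀ᵐ t, t ∉ Ioo (-1 : ℝ) 1 → Tendsto (fun N => R N t) atTop (𝓝 0)
  integral_mul : ∀ N, ∀ Q, UpperDecay Q → ∫ t : ℝ, Q t * R N t = 0

namespace WeaklyNegligible

variable {R : ℕ → ℝ → ℂ} {M : ℝ}

theorem integrable_mul (h : WeaklyNegligible R M) {ψ : ℝ → ℂ} (hψ : Integrable ψ) (N : ℕ) :
    Integrable fun t => ψ t * R N t :=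
  hψ.mul_bdd (h.measurable N).aestronglyMeasurable (h.norm_le N)

theorem tendsto_setIntegral_compl (h : WeaklyNegligible R M) {ψ : ℝ → ℂ} (hψ : Integrable ψ) :
    Tendsto (fun N => ∫ t in (Ioo (-1 : ℝ) 1)ᶜ, ψ t * R N t) atTop (𝓝 0) := by
  rw [← integral_zero ℝ ℂ (μ := volume.restrict (Ioo (-1 : ℝ) 1)ᶜ)]
  refine tendsto_integral_of_dominated_convergence (fun t => ‖ψ t‖ * M)
    (fun N => (h.integrable_mul hψ N).aestronglyMeasurable.restrict)
    (hψ.norm.mul_const M).integrableOn (fun N => ae_restrict_of_ae ?_) ?_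
  · filter_upwards [h.norm_le N] with t ht
    rw [norm_mul]
    gcongr
  · filter_upwards [ae_restrict_mem measurableSet_Ioo.compl, ae_restrict_of_ae h.tendsto_zero]
      with t ht ht'
    simpa using (ht' ht).const_mul (ψ t)

theorem tendsto_setIntegral_upperDecay (h : WeaklyNegligible R M) {Q : ℂ → ℂ}
    (hQ : UpperDecay Q) :
    Tendsto (fun N => ∫ t : ℝ in Ioo (-1 : ℝ) 1, Q t * R N t) atTop (𝓝 0) := by
  have h1 := (h.tendsto_setIntegral_compl hQ.integrable).neg
  rw [neg_zero] at h1
  refine h1.congr fun N => ?_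
  rw [neg_eq_iff_add_eq_zero, add_comm,
    integral_add_compl measurableSet_Ioo (h.integrable_mul hQ.integrable N), h.integral_mul N Q hQ]

theorem tendsto_setIntegral_pow (h : WeaklyNegligible R M) (p : ℕ) :
    Tendsto (fun N => ∫ t : ℝ in Ioo (-1 : ℝ) 1, (t : ℂ) ^ p * R N t) atTop (𝓝 0) := by
  refine tendsto_integral_mul_of_approx h.measurable (fun N => ae_restrict_of_ae (h.norm_le N))
    ?_ fun δ hδ => ?_
  · exact ((Complex.continuous_ofReal.pow p).integrableOn_Icc).mono_set Ioo_subset_Icc_self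
  · obtain ⟨ε, hε, hε0⟩ := (((tendsto_integral_norm_pow_sub_regularizedPow p).eventually
      (ge_mem_nhds hδ)).and self_mem_nhdsWithin).exists
    exact ⟨fun t => regularizedPow p ε t, (upperDecay_regularizedPow p hε0).integrable.integrableOn,
      hε, h.tendsto_setIntegral_upperDecay (upperDecay_regularizedPow p hε0)⟩

theorem integrable_restrict_of_continuous {χ : ℝ → ℂ} (hχ : Continuous χ) :
    Integrable χ (volume.restrict (Ioo (-1 : ℝ) 1)) :=
  hχ.integrableOn_Icc.mono_set Ioo_subset_Icc_self

theorem tendsto_setIntegral_polynomial (h : WeaklyNegligible R M) (p : Polynomial ℝ) :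
    Tendsto (fun N => ∫ t : ℝ in Ioo (-1 : ℝ) 1, ((p.eval t : ℝ) : ℂ) * R N t) atTop (𝓝 0) := by
  have hint : ∀ {χ : ℝ → ℂ}, Continuous χ → ∀ N,
      Integrable (fun t => χ t * R N t) (volume.restrict (Ioo (-1 : ℝ) 1)) := fun hχ N =>
    (integrable_restrict_of_continuous hχ).mul_bdd (h.measurable N).aestronglyMeasurable
      (ae_restrict_of_ae (h.norm_le N))
  induction p using Polynomial.induction_on' with
  | add p q hp hq =>
    have := hp.add hq
    rw [add_zero] at this
    refine this.congr fun N => ?_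
    rw [← integral_add
      (hint (χ := fun t => ((p.eval t : ℝ) : ℂ)) (Complex.continuous_ofReal.comp p.continuous) N)
      (hint (χ := fun t => ((q.eval t : ℝ) : ℂ)) (Complex.continuous_ofReal.comp q.continuous) N)]
    simp [add_mul]
  | monomial n a =>
    have := (h.tendsto_setIntegral_pow n).const_mul (a : ℂ)
    rw [mul_zero] at this
    refine this.congr fun N => ?_
    rw [← integral_const_mul]
    simp [mul_assoc]

theorem tendsto_setIntegral_continuous (h : WeaklyNegligible R M) {χ : ℝ → ℂ}
    (hχ : Continuous χ) :
    Tendsto (fun N => ∫ t in Ioo (-1 : ℝ) 1, χ t * R N t) atTop (𝓝 0) := by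
  have hint : ∀ {χ : ℝ → ℂ}, Continuous χ → ∀ N,
      Integrable (fun t => χ t * R N t) (volume.restrict (Ioo (-1 : ℝ) 1)) := fun hχ N =>
    (integrable_restrict_of_continuous hχ).mul_bdd (h.measurable N).aestronglyMeasurable
      (ae_restrict_of_ae (h.norm_le N))
  refine tendsto_integral_mul_of_approx h.measurable (fun N => ae_restrict_of_ae (h.norm_le N))
    (integrable_restrict_of_continuous hχ) fun δ hδ => ?_
  obtain ⟨p, hp⟩ := exists_polynomial_near_of_continuousOn (-1) 1 (fun t => (χ t).re)
    (Complex.continuous_re.comp hχ).continuousOn (δ / 4) (by positivity)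
  obtain ⟨q, hq⟩ := exists_polynomial_near_of_continuousOn (-1) 1 (fun t => (χ t).im)
    (Complex.continuous_im.comp hχ).continuousOn (δ / 4) (by positivity)
  have hpc : Continuous fun t => ((p.eval t : ℝ) : ℂ) :=
    Complex.continuous_ofReal.comp p.continuous
  have hqc : Continuous fun t => ((q.eval t : ℝ) : ℂ) :=
    Complex.continuous_ofReal.comp q.continuous
  refine ⟨fun t => ((p.eval t : ℝ) : ℂ) + Complex.I * ((q.eval t : ℝ) : ℂ),
    integrable_restrict_of_continuous (hpc.add (continuous_const.mul hqc)), ?_, ?_⟩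
  · have hb : ∀ t ∈ Ioo (-1 : ℝ) 1,
        ‖‖χ t - (((p.eval t : ℝ) : ℂ) + Complex.I * ((q.eval t : ℝ) : ℂ))‖‖ ≤ δ / 2 := by
      intro t ht
      rw [norm_norm]
      have h1 := hp t (Ioo_subset_Icc_self ht)
      have h2 := hq t (Ioo_subset_Icc_self ht)
      rw [abs_sub_comm] at h1 h2
      refine (Complex.norm_le_abs_re_add_abs_im _).trans ?_
      simp only [Complex.sub_re, Complex.add_re, Complex.ofReal_re, Complex.mul_re, Complex.I_re,
        Complex.I_im, Complex.ofReal_im, Complex.sub_im, Complex.add_im, Complex.mul_im, zero_mul,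
        one_mul, mul_zero, sub_zero, add_zero, zero_add]
      linarith
    have h3 := norm_setIntegral_le_of_norm_le_const (μ := volume) (s := Ioo (-1 : ℝ) 1)
      (by simp) hb
    refine (Real.le_norm_self _).trans (h3.trans_eq ?_)
    norm_num [Measure.real]
  · have := (h.tendsto_setIntegral_polynomial p).add
      ((h.tendsto_setIntegral_polynomial q).const_mul Complex.I)
    rw [mul_zero, add_zero] at this
    refine this.congr fun N => ?_
    rw [← integral_const_mul, ← integral_add (hint hpc N) ((hint hqc N).const_mul _)]
    congr 1 with t
    ring

theorem tendsto_integral (h : WeaklyNegligible R M) {φ : ℝ → ℂ} (hφ : Integrable φ) :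
    Tendsto (fun N => ∫ t, φ t * R N t) atTop (𝓝 0) := by
  have h1 : Tendsto (fun N => ∫ t in Ioo (-1 : ℝ) 1, φ t * R N t) atTop (𝓝 0) := by
    refine tendsto_integral_mul_of_approx h.measurable (fun N => ae_restrict_of_ae (h.norm_le N))
      hφ.integrableOn fun δ hδ => ?_
    obtain ⟨χ, -, hd, hχ, hχi⟩ := hφ.integrableOn.exists_hasCompactSupport_integral_sub_le
      (μ := volume.restrict (Ioo (-1 : ℝ) 1)) hδ
    exact ⟨χ, hχi, hd, h.tendsto_setIntegral_continuous hχ⟩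
  have h2 := h1.add (h.tendsto_setIntegral_compl hφ)
  rw [add_zero] at h2
  exact h2.congr fun N => integral_add_compl measurableSet_Ioo (h.integrable_mul hφ N)

end WeaklyNegligible

/-- The Cesàro means of the remainders of even index. -/
noncomputable def remainderMean (f g : ℝ → ℂ) (N : ℕ) (t : ℝ) : ℂ :=
  (N⁻¹ : ℝ) • ∑ i ∈ Finset.range N, remainder f g (2 * (i + 1)) t

theorem norm_inv_smul_sum_le {u : ℕ → ℂ} {K : ℝ} (hK : 0 ≤ K) (hu : ∀ i, ‖u i‖ ≤ K) (N : ℕ) :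
    ‖(N⁻¹ : ℝ) • ∑ i ∈ Finset.range N, u i‖ ≤ K := by
  rcases N.eq_zero_or_pos with rfl | hN
  · simpa using hK
  have hN' : (0 : ℝ) < N := by exact_mod_cast hN
  rw [norm_smul, norm_inv, Real.norm_natCast, inv_mul_le_iff₀ hN']
  refine (norm_sum_le _ _).trans ((Finset.sum_le_sum fun i _ => hu i).trans ?_)
  simp

namespace TestPair

variable {C : NNReal} {f g : ℝ → ℂ}

theorem norm_remainderMean_of_mem_le (h : TestPair C f g) (N : ℕ) {t : ℝ}
    (ht : t ∈ Ioo (-1 : ℝ) 1) : ‖remainderMean f g N t‖ ≤ 2 * C + 6 * (1 + 2 * C) := by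
  have hC := C.coe_nonneg
  rcases N.eq_zero_or_pos with rfl | hN
  · simp only [remainderMean, Finset.range_zero, Finset.sum_empty, smul_zero, norm_zero]
    positivity
  have hN1 : (1 : ℝ) ≤ N := by exact_mod_cast hN
  have e : remainderMean f g N t = (N⁻¹ : ℝ) • ∑ i ∈ Finset.range N,
      transferPrimitive^[2 * (i + 1) + 1] g t +
      (N⁻¹ : ℝ) • (periodicSeq f g (2 * (N + 1)) t - periodicSeq f g 2 t) := by
    have := Finset.sum_range_sub (fun i => periodicSeq f g (2 * (i + 1)) t) N
    rw [zero_add, mul_one] at this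
    rw [remainderMean, ← this, ← smul_add, ← Finset.sum_add_distrib]
    congr 1
    refine Finset.sum_congr rfl fun i _ => ?_
    rw [remainder_of_mem f g _ ht, mul_add_one 2 (i + 1)]
    ring
  have h1 := norm_inv_smul_sum_le (by positivity) (fun i => h.norm_transferPrimitive_le
    (2 * (i + 1)) t) N
  have h2 : ‖(N⁻¹ : ℝ) • (periodicSeq f g (2 * (N + 1)) t - periodicSeq f g 2 t)‖ ≤
      6 * (1 + 2 * C) := by
    rw [norm_smul, norm_inv, Real.norm_natCast, inv_mul_le_iff₀ (by linarith)]
    have h3 := h.norm_periodicSeq_le (2 * (N + 1)) t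
    have h4 := h.norm_periodicSeq_le 2 t
    refine (norm_sub_le _ _).trans ?_
    push_cast at h3 h4
    nlinarith [mul_nonneg (sub_nonneg.2 hN1) hC]
  rw [e]
  exact (norm_add_le _ _).trans (add_le_add h1 h2)

theorem remainderMean_of_one_lt_abs (h : TestPair C f g) (N : ℕ) {t : ℝ} (ht : 1 < |t|) :
    remainderMean f g N t = (N⁻¹ : ℝ) • ∑ i ∈ Finset.range N,
      transferPrimitive^[2 * (i + 1)] g (-t⁻¹) := by
  simp only [remainderMean, h.remainder_of_one_lt_abs _ ht]

theorem norm_remainderMean_of_one_lt_abs_le (h : TestPair C f g) (N : ℕ) {t : ℝ} (ht : 1 < |t|) :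
    ‖remainderMean f g N t‖ ≤ 2 * C := by
  rw [h.remainderMean_of_one_lt_abs N ht]
  exact norm_inv_smul_sum_le (by positivity)
    (fun i => h.norm_transferPrimitive_le (2 * i + 1) (-t⁻¹)) N

theorem tendsto_remainderMean_of_one_lt_abs (h : TestPair C f g) {t : ℝ} (ht : 1 < |t|) :
    Tendsto (fun N => remainderMean f g N t) atTop (𝓝 0) := by
  simp_rw [fun N => h.remainderMean_of_one_lt_abs N ht]
  have hi : Tendsto (fun i : ℕ => 2 * (i + 1)) atTop atTop :=
    tendsto_atTop_mono (fun i => by simp only [id]; omega) tendsto_id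
  exact Tendsto.cesaro_smul ((h.dominated.tendsto_iterate_transferPrimitive
    (neg_inv_mem_Ioo ht)).comp hi)

theorem measurable_remainderMean (h : TestPair C f g) (N : ℕ) :
    Measurable (remainderMean f g N) :=
  (Finset.measurable_fun_sum _ fun _ _ => h.measurable_remainder _).const_smul (N⁻¹ : ℝ)

theorem integral_mul_remainderMean (h : TestPair C f g) (N : ℕ) {ψ : ℝ → ℂ} (hψ : Integrable ψ) :
    ∫ t, ψ t * remainderMean f g N t =
      (N⁻¹ : ℝ) • ∑ i ∈ Finset.range N, ∫ t, ψ t * remainder f g (2 * (i + 1)) t := by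
  rw [← integral_finsetSum _ fun i _ => h.integrable_mul_remainder _ hψ, ← integral_smul]
  simp only [remainderMean, mul_smul_comm, Finset.mul_sum]

theorem integral_char2_mul_periodicSeq_of_le (h : TestPair C f g) (j : ℕ) : ∀ i ≤ j + 1, ∀ m : ℤ,
    0 < m → ∫ t in (-1 : ℝ)..1, char2 m t * periodicSeq f g i t = 0 :=
  fun i _ _ hm => h.integral_char2_mul_periodicSeq i hm

theorem ae_abs_ne_one : ∀ᵐ t : ℝ, |t| ≠ 1 := by
  have : ({1, -1} : Set ℝ)ᶜ ∈ ae volume := (Set.toFinite _).measure_zero _ |> compl_mem_ae_iff.2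
  filter_upwards [this] with t ht h
  exact ht ((abs_eq zero_le_one).1 h)

theorem one_lt_abs_of_notMem {t : ℝ} (h : |t| ≠ 1) (ht : t ∉ Ioo (-1 : ℝ) 1) : 1 < |t| := by
  refine lt_of_le_of_ne (not_lt.1 fun hlt => ht (abs_lt.1 hlt)) h.symm

theorem weaklyNegligible (h : TestPair C f g) :
    WeaklyNegligible (remainderMean f g) (2 * C + 6 * (1 + 2 * C)) where
  measurable := h.measurable_remainderMean
  norm_le N := by
    filter_upwards [ae_abs_ne_one] with t ht
    by_cases hI : t ∈ Ioo (-1 : ℝ) 1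
    · exact h.norm_remainderMean_of_mem_le N hI
    · refine (h.norm_remainderMean_of_one_lt_abs_le N (one_lt_abs_of_notMem ht hI)).trans ?_
      linarith [C.coe_nonneg]
  tendsto_zero := by
    filter_upwards [ae_abs_ne_one] with t ht hI
    exact h.tendsto_remainderMean_of_one_lt_abs (one_lt_abs_of_notMem ht hI)
  integral_mul N Q hQ := by
    rw [h.integral_mul_remainderMean N hQ.integrable, Finset.sum_eq_zero, smul_zero]
    exact fun i _ => h.integral_mul_remainder_eq_zero _ hQ
      (h.integral_char2_mul_periodicSeq_of_le _)

/-- A function orthogonal to both families of exponentials is orthogonal to every test pair. -/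
theorem integral_mul_fst_eq_zero (h : TestPair C f g) {φ : ℝ → ℂ} (hφ : Integrable φ)
    (h1 : ∀ n : ℤ, 0 ≤ n → ∫ t, char2 n t * φ t = 0)
    (h2 : ∀ n : ℤ, 0 ≤ n → ∫ t, char2 n (-t⁻¹) * φ t = 0) : ∫ t, φ t * f t = 0 := by
  refine tendsto_nhds_unique (tendsto_const_nhds.congr' ?_)
    (h.weaklyNegligible.tendsto_integral hφ)
  filter_upwards [eventually_gt_atTop 0] with N hN
  have hN' : (N : ℝ) ≠ 0 := by exact_mod_cast hN.ne'
  have e : ∀ i, ∫ t, φ t * remainder f g (2 * (i + 1)) t = ∫ t, φ t * f t := by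
    intro i
    rw [h.integral_mul_remainder _ hφ h1 h2 (h.integral_char2_mul_periodicSeq_of_le _)]
    simp [alternating]
  simp only [h.integral_mul_remainderMean N hφ, e, Finset.sum_const, Finset.card_range]
  rw [← Nat.cast_smul_eq_nsmul ℝ, inv_smul_smul₀ hN']

end TestPair

/-- The regularized character `e^{iat} / (1 - iδt)²`. -/
noncomputable def regChar (a δ t : ℝ) : ℂ := Complex.exp (Complex.I * a * t) * regularizer δ t

/-- The inversion of the regularized character. -/
noncomputable def regCharInv (a δ t : ℝ) : ℂ :=
  Complex.exp (-(Complex.I * a) / t) * (t * (t + Complex.I * δ)⁻¹) ^ 2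

section

variable {a δ : ℝ}

theorem norm_sq_le_norm_add_sq (hδ : 0 < δ) {z : ℂ} (hz : 0 ≤ z.im) :
    ‖z‖ ^ 2 + δ ^ 2 ≤ ‖z + Complex.I * δ‖ ^ 2 := by
  rw [Complex.sq_norm, Complex.sq_norm, Complex.normSq_apply, Complex.normSq_apply]
  simp
  nlinarith

theorem norm_le_norm_add (hδ : 0 < δ) {z : ℂ} (hz : 0 ≤ z.im) : ‖z‖ ≤ ‖z + Complex.I * δ‖ :=
  le_of_sq_le_sq (by nlinarith [norm_sq_le_norm_add_sq hδ hz]) (norm_nonneg _)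

theorem le_norm_add (hδ : 0 < δ) {z : ℂ} (hz : 0 ≤ z.im) : δ ≤ ‖z + Complex.I * δ‖ :=
  le_of_sq_le_sq (by nlinarith [norm_sq_le_norm_add_sq hδ hz, norm_nonneg z]) (norm_nonneg _)

theorem add_ne_zero_of_im_nonneg (hδ : 0 < δ) {z : ℂ} (hz : 0 ≤ z.im) : z + Complex.I * δ ≠ 0 :=
  norm_pos_iff.1 (hδ.trans_le (le_norm_add hδ hz))

theorem norm_inv_add_le (hδ : 0 < δ) {z : ℂ} (hz : 0 ≤ z.im) :
    ‖(z + Complex.I * δ)⁻¹‖ ≤ δ⁻¹ := by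
  rw [norm_inv]
  exact inv_anti₀ hδ (le_norm_add hδ hz)

theorem norm_mul_inv_add_le_one (hδ : 0 < δ) {z : ℂ} (hz : 0 ≤ z.im) :
    ‖z * (z + Complex.I * δ)⁻¹‖ ≤ 1 := by
  rw [norm_mul, norm_inv]
  exact mul_inv_le_one_of_le₀ (norm_le_norm_add hδ hz) (norm_nonneg _)

theorem norm_exp_neg_I_mul_div (a t : ℝ) : ‖Complex.exp (-(Complex.I * a) / t)‖ = 1 := by
  rw [show -(Complex.I * (a : ℂ)) / t = ((-a / t : ℝ) : ℂ) * Complex.I by push_cast; ring]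
  exact Complex.norm_exp_ofReal_mul_I _

theorem continuous_mul_inv_add (hδ : 0 < δ) :
    Continuous fun t : ℝ => (t : ℂ) * (t + Complex.I * δ)⁻¹ :=
  Complex.continuous_ofReal.mul (Continuous.inv₀ (by fun_prop)
    fun t => add_ne_zero_of_im_nonneg hδ (Complex.ofReal_im t).ge)

theorem measurable_regCharInv (hδ : 0 < δ) : Measurable (regCharInv a δ) :=
  (Complex.measurable_exp.comp (measurable_const.div Complex.measurable_ofReal)).mul
    ((continuous_mul_inv_add hδ).measurable.pow_const 2)

theorem norm_regChar_le (ha : 0 ≤ a) (hδ : 0 ≤ δ) (t : ℝ) : ‖regChar a δ t‖ ≤ 1 := by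
  have ht : 0 ≤ (t : ℂ).im := (Complex.ofReal_im t).ge
  rw [regChar, norm_mul]
  exact mul_le_one₀ (norm_exp_I_mul_le_one ha ht) (norm_nonneg _) (norm_regularizer_le hδ ht)

theorem norm_regCharInv_le (hδ : 0 < δ) (t : ℝ) : ‖regCharInv a δ t‖ ≤ 1 := by
  rw [regCharInv, norm_mul, norm_exp_neg_I_mul_div, one_mul, norm_pow]
  exact pow_le_one₀ (norm_nonneg _) (norm_mul_inv_add_le_one hδ (Complex.ofReal_im t).ge)

theorem regChar_neg_inv (hδ : 0 < δ) {t : ℝ} (ht : t ≠ 0) :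
    regChar a δ (-t⁻¹) = regCharInv a δ t := by
  have ht' : (t : ℂ) ≠ 0 := by exact_mod_cast ht
  have hw := add_ne_zero_of_im_nonneg hδ (Complex.ofReal_im t).ge
  have e : (1 - Complex.I * δ * ((-t⁻¹ : ℝ) : ℂ))⁻¹ = t * (t + Complex.I * δ)⁻¹ := by
    rw [inv_eq_iff_eq_inv, mul_inv, inv_inv]
    push_cast
    field_simp
    ring
  rw [regChar, regularizer, regCharInv, e]
  congr 2
  push_cast
  ring

theorem hasDerivAt_regCharInv_zero (hδ : 0 < δ) : HasDerivAt (regCharInv a δ) 0 0 := by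
  have h : regCharInv a δ =O[𝓝 0] fun t : ℝ => ‖t - 0‖ ^ 2 := by
    refine Asymptotics.IsBigO.of_bound ((δ⁻¹) ^ 2) (Eventually.of_forall fun t => ?_)
    rw [regCharInv, norm_mul, norm_exp_neg_I_mul_div, one_mul, norm_pow, norm_mul, sub_zero,
      Complex.norm_real, mul_pow, mul_comm, norm_pow, norm_norm]
    gcongr
    exact norm_inv_add_le hδ (Complex.ofReal_im t).ge
  exact (h.hasFDerivAt (𝕜 := ℝ) one_lt_two).hasDerivAt

theorem hasDerivAt_regCharInv (hδ : 0 < δ) {t : ℝ} (ht : t ≠ 0) :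
    HasDerivAt (regCharInv a δ) (Complex.exp (-(Complex.I * a) / t) *
      (Complex.I * a * (t + Complex.I * δ)⁻¹ ^ 2 + 2 * (t * (t + Complex.I * δ)⁻¹) *
        (t + Complex.I * δ)⁻¹ - 2 * (t * (t + Complex.I * δ)⁻¹) ^ 2 *
          (t + Complex.I * δ)⁻¹)) t := by
  have ht' : (t : ℂ) ≠ 0 := by exact_mod_cast ht
  have hw := add_ne_zero_of_im_nonneg hδ (Complex.ofReal_im t).ge
  have h0 : HasDerivAt (fun z : ℂ => z) 1 (t : ℂ) := hasDerivAt_id _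
  have h1 := ((hasDerivAt_const (t : ℂ) (-(Complex.I * a))).fun_div h0 ht').cexp
  have h2 := (h0.fun_mul ((h0.add_const (Complex.I * δ)).fun_inv hw)).fun_pow 2
  refine ((h1.fun_mul h2).comp_ofReal).congr_deriv ?_
  rw [show 2 - 1 = 1 from rfl, pow_one, Nat.cast_ofNat]
  generalize (t : ℂ) + Complex.I * δ = w at hw
  field_simp
  ring

theorem norm_regCharInv_sub_le (ha : 0 ≤ a) (hδ : 0 < δ) (s t : ℝ) :
    ‖regCharInv a δ t - regCharInv a δ s‖ ≤ (a * δ⁻¹ ^ 2 + 4 * δ⁻¹) * |t - s| := by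
  have hK : 0 ≤ a * δ⁻¹ ^ 2 + 4 * δ⁻¹ := by positivity
  have h : ∀ x : ℝ, ∃ d, HasDerivAt (regCharInv a δ) d x ∧ ‖d‖ ≤ a * δ⁻¹ ^ 2 + 4 * δ⁻¹ := by
    intro x
    rcases eq_or_ne x 0 with rfl | hx
    · exact ⟨0, hasDerivAt_regCharInv_zero hδ, by simpa using hK⟩
    · refine ⟨_, hasDerivAt_regCharInv hδ hx, ?_⟩
      have hx0 : 0 ≤ (x : ℂ).im := (Complex.ofReal_im x).ge
      have b1 := norm_inv_add_le hδ hx0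
      have b2 := norm_mul_inv_add_le_one hδ hx0
      rw [norm_mul, norm_exp_neg_I_mul_div, one_mul]
      have c1 : ‖Complex.I * a * ((x : ℂ) + Complex.I * δ)⁻¹ ^ 2‖ ≤ a * δ⁻¹ ^ 2 := by
        rw [norm_mul, norm_mul, Complex.norm_I, one_mul, Complex.norm_real,
          Real.norm_of_nonneg ha, norm_pow]
        gcongr
      have c2 : ‖2 * ((x : ℂ) * ((x : ℂ) + Complex.I * δ)⁻¹) * ((x : ℂ) + Complex.I * δ)⁻¹‖ ≤
          2 * 1 * δ⁻¹ := by
        rw [norm_mul, norm_mul, Complex.norm_ofNat]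
        gcongr
      have c3 : ‖2 * ((x : ℂ) * ((x : ℂ) + Complex.I * δ)⁻¹) ^ 2 *
          ((x : ℂ) + Complex.I * δ)⁻¹‖ ≤ 2 * 1 ^ 2 * δ⁻¹ := by
        rw [norm_mul, norm_mul, Complex.norm_ofNat, norm_pow]
        gcongr
      refine (norm_sub_le _ _).trans ((add_le_add (norm_add_le _ _) le_rfl).trans ?_)
      linarith
  choose d hd hb using h
  exact convex_univ.norm_image_sub_le_of_norm_hasDerivWithin_le
    (fun x _ => (hd x).hasDerivWithinAt) (fun x _ => hb x) (mem_univ s) (mem_univ t)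

theorem UpperDecay.mul_inv_add_sq_mul {Q : ℂ → ℂ} (hQ : UpperDecay Q) (hδ : 0 < δ) :
    UpperDecay fun z => (z * (z + Complex.I * δ)⁻¹) ^ 2 * Q z := by
  refine hQ.mul (B := fun z => (z * (z + Complex.I * δ)⁻¹) ^ 2) (K := 1) (fun z hz => ?_)
    fun z hz => ?_
  · have h : DifferentiableAt ℂ (fun z : ℂ => z + Complex.I * δ) z := by fun_prop
    exact (differentiableAt_id.fun_mul (h.fun_inv (add_ne_zero_of_im_nonneg hδ hz))).fun_pow 2
  · rw [norm_pow]
    exact pow_le_one₀ (norm_nonneg _) (norm_mul_inv_add_le_one hδ hz)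

theorem testPair_regChar (ha : 0 ≤ a) (hδ : 0 < δ) :
    TestPair (a * δ⁻¹ ^ 2 + 4 * δ⁻¹).toNNReal (regChar a δ) (regCharInv a δ) where
  measurable_fst := Measurable.mul (by fun_prop) (continuous_regularizer hδ.le).measurable
  measurable_snd := measurable_regCharInv hδ
  norm_fst_le := norm_regChar_le ha hδ.le
  norm_snd_le := norm_regCharInv_le hδ
  fst_neg_inv _ ht := regChar_neg_inv hδ ht
  dominated := by
    refine Dominated.of_lipschitz (measurable_regCharInv hδ) (by simp [regCharInv])
      fun s _ t _ => ?_
    rw [Real.coe_toNNReal _ (by positivity)]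
    exact norm_regCharInv_sub_le ha hδ s t
  integral_fst_mul Q hQ := by
    have hB : UpperDecay fun z => regularizer δ z * Q z :=
      hQ.mul (fun z hz => (differentiableAt_inv_one_sub hδ.le hz).pow 2)
        (fun z hz => norm_regularizer_le hδ.le hz)
    rw [← hB.integral_exp_mul_exp_eq_zero ha le_rfl]
    congr 1 with t
    simp [regChar, mul_assoc]
  integral_snd_mul Q hQ := by
    rw [← (hQ.mul_inv_add_sq_mul hδ).integral_exp_mul_exp_eq_zero le_rfl ha]
    congr 1 with t
    simp [regCharInv, mul_assoc]

end

theorem integral_exp_mul_eq_zero {φ : ℝ → ℂ} (hφ : Integrable φ)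
    (h1 : ∀ n : ℤ, 0 ≤ n → ∫ t, char2 n t * φ t = 0)
    (h2 : ∀ n : ℤ, 0 ≤ n → ∫ t, char2 n (-t⁻¹) * φ t = 0) {a : ℝ} (ha : 0 ≤ a) :
    ∫ t : ℝ, Complex.exp (Complex.I * a * t) * φ t = 0 := by
  have hlim : Tendsto (fun δ => ∫ t, φ t * regChar a δ t) (𝓝[>] 0)
      (𝓝 (∫ t : ℝ, Complex.exp (Complex.I * a * t) * φ t)) := by
    refine tendsto_integral_filter_of_dominated_convergence (fun t => ‖φ t‖) ?_ ?_ hφ.norm ?_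
    · filter_upwards [self_mem_nhdsWithin] with δ hδ
      exact hφ.aestronglyMeasurable.mul (testPair_regChar ha hδ).measurable_fst.aestronglyMeasurable
    · filter_upwards [self_mem_nhdsWithin] with δ hδ
      refine Eventually.of_forall fun t => ?_
      rw [norm_mul]
      exact mul_le_of_le_one_right (norm_nonneg _) (norm_regChar_le ha (le_of_lt hδ) t)
    · refine Eventually.of_forall fun t => ?_
      have := ((tendsto_regularizer (t : ℂ)).const_mul
        (Complex.exp (Complex.I * a * t))).const_mul (φ t)
      rw [mul_one, mul_comm (φ t)] at this
      exact this.mono_left nhdsWithin_le_nhds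
  refine tendsto_nhds_unique hlim (tendsto_const_nhds.congr' ?_)
  filter_upwards [self_mem_nhdsWithin] with δ hδ
  exact ((testPair_regChar ha hδ).integral_mul_fst_eq_zero hφ h1 h2).symm

end

/-- If `φ ∈ L¹(ℝ)` satisfies `∫ e^{iπnt} φ(t) dt = 0` and
`∫ e^{-iπn/t} φ(t) dt = 0` for every integer `n ≥ 0`, then the Fourier transform
`φ̂(ξ) = ∫ e^{-2πiξt} φ(t) dt` vanishes for every `ξ < 0`, i.e. `φ ∈ H¹₊(ℝ)`. -/
theorem statement1 (φ : ℝ → ℂ) (hφ : Integrable φ)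
    (h1 : ∀ n : ℤ, 0 ≤ n →
      ∫ t : ℝ, Complex.exp (Complex.I * (Real.pi : ℂ) * (n : ℂ) * (t : ℂ)) * φ t = 0)
    (h2 : ∀ n : ℤ, 0 ≤ n →
      ∫ t : ℝ, Complex.exp (-(Complex.I * (Real.pi : ℂ) * (n : ℂ)) / (t : ℂ)) * φ t = 0) :
    ∀ ξ : ℝ, ξ < 0 →
      ∫ t : ℝ, Complex.exp (-(2 * (Real.pi : ℂ) * Complex.I * (ξ : ℂ) * (t : ℂ))) * φ t = 0 := by
  intro ξ hξ
  have h := integral_exp_mul_eq_zero hφ (fun n hn => h1 n hn) (fun n hn => ?_)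
    (a := -(2 * Real.pi * ξ)) (by nlinarith [Real.pi_pos])
  · rw [← h]
    congr 1 with t
    congr 2
    push_cast
    ring
  · rw [← h2 n hn]
    congr 1 with t
    rw [char2]
    congr 2
    push_cast
    ring
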